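/- Lower bound (direct part): for the channel Φ^(n)(ρ^(n)) = Σ_{i=1}^M γ_i φ_i^{⊗n}(ρ^(n)), the entanglement-assisted classical capacity satisfies C_ea(Φ) ≥ max_ρ min_{1≤i≤M} I(ρ; φ_i). -/

import Mathlib

open Matrix BigOperators
open scoped ComplexOrder

noncomputable section

variable {n m r : Type*} [Fintype n] [DecidableEq n] [Fintype m] [DecidableEq m] [Fintype r] [DecidableEq r]

/-- A density matrix: positive semidefinite with unit trace. -/
def IsDensity (ρ : Matrix n n ℂ) : Prop := ρ.PosSemidef ∧ ρ.trace = 1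

/-- Functional calculus for (Hermitian) matrices, junk value `0` otherwise. -/
noncomputable def matFun (f : ℝ → ℝ) (A : Matrix n n ℂ) : Matrix n n ℂ :=
  if h : A.IsHermitian then
    (h.eigenvectorUnitary : Matrix n n ℂ) *
      Matrix.diagonal (fun i => (f (h.eigenvalues i) : ℂ)) *
      star (h.eigenvectorUnitary : Matrix n n ℂ)
  else 0

/-- Von Neumann entropy (base 2), via eigenvalues; junk value `0` for non-Hermitian input. -/
noncomputable def vnEntropy (A : Matrix n n ℂ) : ℝ :=
  if h : A.IsHermitian then (∑ i, Real.negMulLog (h.eigenvalues i)) / Real.log 2 else 0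

/-- Quantum relative entropy `S(ρ‖σ) = Tr ρ (log ρ - log σ)` (base 2). -/
noncomputable def relEnt (ρ σ : Matrix n n ℂ) : ℝ :=
  ((ρ * matFun Real.log ρ).trace - (ρ * matFun Real.log σ).trace).re / Real.log 2

/-- The extension `φ ⊗ id` of a linear map on matrices to a bipartite system. -/
def tensorExt (φ : Matrix n n ℂ →ₗ[ℂ] Matrix m m ℂ) (M : Matrix (n × r) (n × r) ℂ) :
    Matrix (m × r) (m × r) ℂ :=
  Matrix.of fun p q => φ (Matrix.of fun i j => M (i, p.2) (j, q.2)) p.1 q.1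

/-- Completely positive trace preserving map. -/
def IsCPTP (φ : Matrix n n ℂ →ₗ[ℂ] Matrix m m ℂ) : Prop :=
  (∀ A, (φ A).trace = A.trace) ∧
    (∀ (k : ℕ) (M : Matrix (n × Fin k) (n × Fin k) ℂ), M.PosSemidef → (tensorExt φ M).PosSemidef)

/-- Partial trace over the second factor. -/
def partialTraceR (M : Matrix (n × r) (n × r) ℂ) : Matrix n n ℂ :=
  Matrix.of fun i j => ∑ k, M (i, k) (j, k)

/-- A pure state: rank-one projection onto a unit vector. -/
def IsPureState (ψ : Matrix n n ℂ) : Prop :=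
  ∃ v : n → ℂ, (∑ i, Complex.normSq (v i)) = 1 ∧ ψ = Matrix.vecMulVec v (star v)

end

/-! ### Kraus channels, mutual information, and the entanglement-assisted coding protocol -/

/-- A Kraus family: completeness relation `∑ Kₛ† Kₛ = 1`. -/
def IsKraus {dI dO S : ℕ} (K : Fin S → Matrix (Fin dO) (Fin dI) ℂ) : Prop :=
  ∑ s, (K s)ᴴ * K s = 1

/-- Action of a Kraus channel. -/
noncomputable def krausApply {dI dO S : ℕ} (K : Fin S → Matrix (Fin dO) (Fin dI) ℂ)
    (ρ : Matrix (Fin dI) (Fin dI) ℂ) : Matrix (Fin dO) (Fin dO) ℂ :=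
  ∑ s, K s * ρ * (K s)ᴴ

open Kronecker in
/-- Action of `φ ⊗ id_R` for a Kraus channel `φ`. -/
noncomputable def krausApplyExt {dI dO dR S : ℕ} (K : Fin S → Matrix (Fin dO) (Fin dI) ℂ)
    (M : Matrix (Fin dI × Fin dR) (Fin dI × Fin dR) ℂ) :
    Matrix (Fin dO × Fin dR) (Fin dO × Fin dR) ℂ :=
  ∑ s, (K s ⊗ₖ (1 : Matrix (Fin dR) (Fin dR) ℂ)) * M *
    (K s ⊗ₖ (1 : Matrix (Fin dR) (Fin dR) ℂ))ᴴ

/-- The canonical purification of a state `ρ`, given by the vectorisation of `√ρ`. -/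
noncomputable def canonPurif {d : ℕ} (ρ : Matrix (Fin d) (Fin d) ℂ) :
    Matrix (Fin d × Fin d) (Fin d × Fin d) ℂ :=
  Matrix.vecMulVec (fun p => matFun Real.sqrt ρ p.1 p.2)
    (star fun p => matFun Real.sqrt ρ p.1 p.2)

/-- Quantum mutual information `I(ρ;φ) = S(ρ) + S(φ(ρ)) - S((φ ⊗ id)ψ_ρ)`. -/
noncomputable def qmi {dI dO S : ℕ} (K : Fin S → Matrix (Fin dO) (Fin dI) ℂ)
    (ρ : Matrix (Fin dI) (Fin dI) ℂ) : ℝ :=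
  vnEntropy ρ + vnEntropy (krausApply K ρ) - vnEntropy (krausApplyExt K (canonPurif ρ))

/-- Index set for one `m`-block of Alice's and Bob's systems (channel input side). -/
abbrev BlkIn (dH dB m : ℕ) := (Fin m → Fin dH) × (Fin m → Fin dB)

/-- Index set for one `m`-block of Alice's and Bob's systems (channel output side). -/
abbrev BlkOut (dK dB m : ℕ) := (Fin m → Fin dK) × (Fin m → Fin dB)

/-- The Kraus operator of `φᵢ^{⊗ mn} ⊗ id_B^{⊗ mn}` labelled by `s`. -/
noncomputable def bigKraus {dH dK S Mbr : ℕ} (dB m n : ℕ)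
    (Kr : Fin Mbr → Fin S → Matrix (Fin dK) (Fin dH) ℂ)
    (i : Fin Mbr) (s : Fin n → Fin m → Fin S) :
    Matrix (Fin n → BlkOut dK dB m) (Fin n → BlkIn dH dB m) ℂ :=
  Matrix.of fun f g => ∏ k,
    ((∏ l, Kr i (s k l) ((f k).1 l) ((g k).1 l)) *
      (if (f k).2 = (g k).2 then (1 : ℂ) else 0))

/-- Output of the long-term memory channel `Σᵢ γᵢ φᵢ^{⊗mn} ⊗ id_B^{⊗mn}` on a codeword. -/
noncomputable def chanOut {dH dK S Mbr : ℕ} (dB m n : ℕ)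
    (Kr : Fin Mbr → Fin S → Matrix (Fin dK) (Fin dH) ℂ) (γ : Fin Mbr → ℝ)
    (ρcw : Matrix (Fin n → BlkIn dH dB m) (Fin n → BlkIn dH dB m) ℂ) :
    Matrix (Fin n → BlkOut dK dB m) (Fin n → BlkOut dK dB m) ℂ :=
  ∑ i, γ i • ∑ s : Fin n → Fin m → Fin S,
    bigKraus dB m n Kr i s * ρcw * (bigKraus dB m n Kr i s)ᴴ

/-- The codeword for message `α`: the product over the `n` blocks of the states obtained by
applying Alice's local encoding maps to her shares of the entangled state `Ψ`. -/
noncomputable def codeword {dH dB m n Msz : ℕ}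
    (E : Fin Msz → Fin n →
      (Matrix (Fin m → Fin dH) (Fin m → Fin dH) ℂ →ₗ[ℂ]
        Matrix (Fin m → Fin dH) (Fin m → Fin dH) ℂ))
    (Ψ : Matrix (BlkIn dH dB m) (BlkIn dH dB m) ℂ) (α : Fin Msz) :
    Matrix (Fin n → BlkIn dH dB m) (Fin n → BlkIn dH dB m) ℂ :=
  Matrix.of fun f g => ∏ k, tensorExt (E α k) Ψ (f k) (g k)

/-- Average probability of error of a code (messages equidistributed). -/
noncomputable def codeError {dH dK S Mbr : ℕ} (dB m n Msz : ℕ)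
    (Kr : Fin Mbr → Fin S → Matrix (Fin dK) (Fin dH) ℂ) (γ : Fin Mbr → ℝ)
    (Ψ : Matrix (BlkIn dH dB m) (BlkIn dH dB m) ℂ)
    (E : Fin Msz → Fin n →
      (Matrix (Fin m → Fin dH) (Fin m → Fin dH) ℂ →ₗ[ℂ]
        Matrix (Fin m → Fin dH) (Fin m → Fin dH) ℂ))
    (F : Fin Msz → Matrix (Fin n → BlkOut dK dB m) (Fin n → BlkOut dK dB m) ℂ) : ℝ :=
  1 - (Msz : ℝ)⁻¹ *
    ∑ α, ((F α * chanOut dB m n Kr γ (codeword E Ψ α)).trace).re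

/-- `R` is an achievable rate for `m`-block encodings using the shared entangled state `Ψ`:
there are codes of sizes `Msz n` with `R ≤ liminf (1/n) log Msz n`, CPTP encodings, and
POVM decodings whose average error probability vanishes as `n → ∞`. -/
def AchievableRate {dH dK S Mbr : ℕ} (Kr : Fin Mbr → Fin S → Matrix (Fin dK) (Fin dH) ℂ)
    (γ : Fin Mbr → ℝ) (m dB : ℕ)
    (Ψ : Matrix (BlkIn dH dB m) (BlkIn dH dB m) ℂ) (R : ℝ) : Prop :=
  ∃ Msz : ℕ → ℕ, (∀ n, 1 ≤ Msz n) ∧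
    R ≤ Filter.atTop.liminf (fun n => Real.logb 2 (Msz n) / n) ∧
    ∃ E : (n : ℕ) → Fin (Msz n) → Fin n →
        (Matrix (Fin m → Fin dH) (Fin m → Fin dH) ℂ →ₗ[ℂ]
          Matrix (Fin m → Fin dH) (Fin m → Fin dH) ℂ),
      ∃ F : (n : ℕ) → Fin (Msz n) →
          Matrix (Fin n → BlkOut dK dB m) (Fin n → BlkOut dK dB m) ℂ,
        (∀ n α k, IsCPTP (E n α k)) ∧
        (∀ n α, (F n α).PosSemidef) ∧
        (∀ n : ℕ, ((1 : Matrix (Fin n → BlkOut dK dB m) (Fin n → BlkOut dK dB m) ℂ)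
            - ∑ α, F n α).PosSemidef) ∧
        Filter.Tendsto (fun n => codeError dB m n (Msz n) Kr γ Ψ (E n) (F n))
          Filter.atTop (nhds 0)

/-- The `m`-shot entanglement-assisted classical capacity: supremum of achievable rates
over all shared entangled pure states (of arbitrary Bob dimension). -/
noncomputable def CeaM {dH dK S Mbr : ℕ}
    (Kr : Fin Mbr → Fin S → Matrix (Fin dK) (Fin dH) ℂ) (γ : Fin Mbr → ℝ) (m : ℕ) : ℝ :=
  sSup {R : ℝ | ∃ dB : ℕ, ∃ Ψ : Matrix (BlkIn dH dB m) (BlkIn dH dB m) ℂ,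
    IsPureState Ψ ∧ AchievableRate Kr γ m dB Ψ R}

/-- The full entanglement-assisted classical capacity `C_ea = limsup_m (1/m) C_ea^{(m)}`. -/
noncomputable def Cea {dH dK S Mbr : ℕ}
    (Kr : Fin Mbr → Fin S → Matrix (Fin dK) (Fin dH) ℂ) (γ : Fin Mbr → ℝ) : ℝ :=
  Filter.atTop.limsup (fun m => CeaM Kr γ m / m)

section SequentialDecoding

variable {E : Type*} [NormedAddCommGroup E] [InnerProductSpace ℂ E] [FiniteDimensional ℂ E]

/-- The vector obtained from `ξ` by successively projecting onto `Q 0, …, Q (n - 1)`. -/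
noncomputable def projChain (Q : ℕ → Submodule ℂ E) : ℕ → E →L[ℂ] E
  | 0 => ContinuousLinearMap.id ℂ E
  | k + 1 => (Q k).starProjection ∘L projChain Q k

lemma norm_sq_eq_add_orthogonal (V : Submodule ℂ E) (x : E) :
    ‖x‖ ^ 2 = ‖V.starProjection x‖ ^ 2 + ‖Vᗮ.starProjection x‖ ^ 2 :=
  V.norm_sq_eq_add_norm_sq_starProjection x

lemma starProjection_orthogonal_apply' (V : Submodule ℂ E) (x : E) :
    Vᗮ.starProjection x = x - V.starProjection x := by
  simp

lemma sum_norm_sq_projChain (Q : ℕ → Submodule ℂ E) (ξ : E) (n : ℕ) :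
    ∑ k ∈ Finset.range n, ‖(Q k)ᗮ.starProjection (projChain Q k ξ)‖ ^ 2
      = ‖ξ‖ ^ 2 - ‖projChain Q n ξ‖ ^ 2 := by
  induction n with
  | zero => simp [projChain]
  | succ n ih =>
    rw [Finset.sum_range_succ, ih, norm_sq_eq_add_orthogonal (Q n) (projChain Q n ξ)]
    simp only [projChain, ContinuousLinearMap.comp_apply]
    ring

lemma sub_projChain (Q : ℕ → Submodule ℂ E) (ξ : E) (n : ℕ) :
    ξ - projChain Q n ξ
      = ∑ k ∈ Finset.range n, (Q k)ᗮ.starProjection (projChain Q k ξ) := by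
  induction n with
  | zero => simp [projChain]
  | succ n ih =>
    rw [Finset.sum_range_succ, ← ih, starProjection_orthogonal_apply']
    simp [projChain]

/-- Gao's noncommutative union bound for vectors. -/
lemma norm_sq_sub_projChain_le (Q : ℕ → Submodule ℂ E) (ξ : E) (n : ℕ) :
    ‖ξ‖ ^ 2 - ‖projChain Q n ξ‖ ^ 2
      ≤ 4 * ∑ k ∈ Finset.range n, ‖(Q k)ᗮ.starProjection ξ‖ ^ 2 := by
  set e := ∑ k ∈ Finset.range n, ‖(Q k)ᗮ.starProjection ξ‖ ^ 2 with he
  have hsum := sum_norm_sq_projChain Q ξ n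
  have hf : ‖projChain Q n ξ‖ ^ 2 ≤ ‖ξ‖ ^ 2 := by
    have : 0 ≤ ‖ξ‖ ^ 2 - ‖projChain Q n ξ‖ ^ 2 := by
      rw [← hsum]; positivity
    linarith
  have hf' : ‖projChain Q n ξ‖ ≤ ‖ξ‖ := by
    exact (sq_le_sq₀ (norm_nonneg _) (norm_nonneg _)).1 hf
  have h1 : ‖ξ‖ ^ 2 - ‖ξ‖ * ‖projChain Q n ξ‖
      ≤ ∑ k ∈ Finset.range n, ‖(Q k)ᗮ.starProjection ξ‖ *
          ‖(Q k)ᗮ.starProjection (projChain Q k ξ)‖ := by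
    have h2 : ‖ξ‖ ^ 2 - ‖ξ‖ * ‖projChain Q n ξ‖ ≤ (inner ℂ ξ (ξ - projChain Q n ξ)).re := by
      rw [inner_sub_right, Complex.sub_re]
      have h3 := re_inner_le_norm (𝕜 := ℂ) ξ (projChain Q n ξ)
      have h4 : (inner ℂ ξ ξ).re = ‖ξ‖ ^ 2 := by
        have := inner_self_eq_norm_sq (𝕜 := ℂ) ξ
        simpa using this
      simp only [RCLike.re_to_complex] at h3
      linarith
    refine h2.trans ?_
    rw [sub_projChain, inner_sum, Complex.re_sum]
    refine Finset.sum_le_sum fun k _ => ?_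
    have h5 : inner ℂ ξ ((Q k)ᗮ.starProjection (projChain Q k ξ))
        = inner ℂ ((Q k)ᗮ.starProjection ξ) ((Q k)ᗮ.starProjection (projChain Q k ξ)) := by
      rw [Submodule.inner_starProjection_left_eq_right]
      congr 1
      exact (Submodule.starProjection_eq_self_iff.2 (Submodule.starProjection_apply_mem _ _)).symm
    rw [h5]
    exact re_inner_le_norm (𝕜 := ℂ) ((Q k)ᗮ.starProjection ξ)
      ((Q k)ᗮ.starProjection (projChain Q k ξ))
  have h6 := Finset.sum_mul_sq_le_sq_mul_sq (Finset.range n)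
    (fun k => ‖(Q k)ᗮ.starProjection ξ‖) (fun k => ‖(Q k)ᗮ.starProjection (projChain Q k ξ)‖)
  rw [hsum, ← he] at h6
  set a := ‖ξ‖
  set f := ‖projChain Q n ξ‖
  have ha : 0 ≤ a := norm_nonneg _
  have hf0 : 0 ≤ f := norm_nonneg _
  have he0 : 0 ≤ e := by positivity
  have h7 : (a ^ 2 - a * f) ^ 2 ≤ e * (a ^ 2 - f ^ 2) :=
    (pow_le_pow_left₀ (by nlinarith) h1 2).trans h6
  rcases hf'.eq_or_lt with h | h
  · rw [h]; nlinarith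
  · have h8 : a ^ 2 * (a - f) ≤ e * (a + f) := by
      have : (a - f) * (a ^ 2 * (a - f)) ≤ (a - f) * (e * (a + f)) := by nlinarith
      exact le_of_mul_le_mul_left this (by linarith)
    have h9 : a * (a - f) ≤ 2 * e := by
      have hap : 0 < a := lt_of_le_of_lt hf0 h
      have : a * (a * (a - f)) ≤ a * (2 * e) := by nlinarith
      exact le_of_mul_le_mul_left this hap
    nlinarith

/-- The sequential decoder: reject `V 0, …, V (x - 1)`, then accept `V x`. -/
noncomputable def seqDec (V : ℕ → Submodule ℂ E) (x : ℕ) : E →L[ℂ] E :=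
  (V x).starProjection ∘L projChain (fun k => (V k)ᗮ) x

lemma projChain_congr {Q Q' : ℕ → Submodule ℂ E} {n : ℕ} (h : ∀ k < n, Q k = Q' k) :
    projChain Q n = projChain Q' n := by
  induction n with
  | zero => rfl
  | succ n ih =>
    simp only [projChain]
    rw [ih fun k hk => h k (hk.trans n.lt_succ_self)]
    simp only [h n n.lt_succ_self]

lemma norm_sq_sub_seqDec_le (V : ℕ → Submodule ℂ E) (ξ : E) (x : ℕ) :
    ‖ξ‖ ^ 2 - ‖seqDec V x ξ‖ ^ 2 ≤ 4 * (‖(V x)ᗮ.starProjection ξ‖ ^ 2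
      + ∑ k ∈ Finset.range x, ‖(V k).starProjection ξ‖ ^ 2) := by
  have h := norm_sq_sub_projChain_le (fun k => if k < x then (V k)ᗮ else V k) ξ (x + 1)
  have h1 : projChain (fun k => if k < x then (V k)ᗮ else V k) (x + 1) = seqDec V x := by
    simp only [projChain, seqDec, lt_irrefl, if_false]
    rw [projChain_congr]
    intro k hk
    simp [hk]
  rw [h1, Finset.sum_range_succ] at h
  refine h.trans_eq ?_
  rw [add_comm]
  simp only [lt_irrefl, if_false]
  congr 2
  refine Finset.sum_congr rfl fun k hk => ?_
  simp [Finset.mem_range.1 hk]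

lemma norm_seqDec_le (V : ℕ → Submodule ℂ E) (ξ : E) (x : ℕ) :
    ‖seqDec V x ξ‖ ^ 2 ≤ ‖ξ‖ ^ 2 := by
  have h := sum_norm_sq_projChain (fun k => (V k)ᗮ) ξ x
  have h0 : 0 ≤ ∑ k ∈ Finset.range x,
      ‖(V k)ᗮᗮ.starProjection (projChain (fun k => (V k)ᗮ) k ξ)‖ ^ 2 := by positivity
  have h1 := norm_sq_eq_add_orthogonal (V x) (projChain (fun k => (V k)ᗮ) x ξ)
  have h2 := sq_nonneg ‖(V x)ᗮ.starProjection (projChain (fun k => (V k)ᗮ) x ξ)‖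
  simp only [seqDec, ContinuousLinearMap.comp_apply]
  linarith

lemma sum_norm_sq_seqDec_le (V : ℕ → Submodule ℂ E) (ξ : E) (n : ℕ) :
    ∑ x ∈ Finset.range n, ‖seqDec V x ξ‖ ^ 2 ≤ ‖ξ‖ ^ 2 := by
  have h := sum_norm_sq_projChain (fun k => (V k)ᗮ) ξ n
  simp only [Submodule.orthogonal_orthogonal] at h
  have h2 := sq_nonneg ‖projChain (fun k => (V k)ᗮ) n ξ‖
  simp only [seqDec, ContinuousLinearMap.comp_apply]
  linarith

/-- Overlap of a family of vectors `η` with the span of vectors `u j` lying in an increasing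
family of subspaces on which the quadratic form of `η` is controlled. -/
lemma sum_norm_sq_starProjection_span_le {ℓ J : Type*} [Fintype ℓ] [DecidableEq J]
    (η : ℓ → E) (u : J → E) (c : J → ℝ) (G : ℝ → Submodule ℂ E) (hG : Monotone G)
    (hc : ∀ j, 0 ≤ c j) (hu : ∀ j, u j ∈ G (c j))
    (hη : ∀ j, ∀ x ∈ G (c j), ∑ l, ‖inner ℂ x (η l)‖ ^ 2 ≤ c j * ‖x‖ ^ 2) (A : Finset J) :
    ∑ l, ‖(Submodule.span ℂ (u '' A)).starProjection (η l)‖ ^ 2 ≤ ∑ j ∈ A, c j := by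
  induction A using Finset.induction_on_max_value c with
  | empty => simp
  | insert a s has hmax ih =>
    rw [Finset.sum_insert has]
    set V := Submodule.span ℂ (u '' s) with hV
    set b := Vᗮ.starProjection (u a) with hb
    have hVG : V ≤ G (c a) := by
      rw [hV, Submodule.span_le]
      rintro _ ⟨j, hj, rfl⟩
      exact hG (hmax j hj) (hu j)
    have hbG : b ∈ G (c a) := by
      rw [hb, starProjection_orthogonal_apply']
      exact Submodule.sub_mem _ (hu a) (hVG (Submodule.starProjection_apply_mem _ _))
    have hbV : b ∈ Vᗮ := Submodule.starProjection_apply_mem _ _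
    have hspan : Submodule.span ℂ (u '' ↑(insert a s)) = V ⊔ Submodule.span ℂ {b} := by
      rw [Finset.coe_insert, Set.image_insert_eq, Submodule.span_insert, ← hV, sup_comm]
      have hua : u a = V.starProjection (u a) + b := by
        rw [hb, starProjection_orthogonal_apply']; abel
      apply le_antisymm
      · refine sup_le le_sup_left ?_
        rw [Submodule.span_singleton_le_iff_mem, hua]
        exact Submodule.add_mem_sup (Submodule.starProjection_apply_mem _ _)
          (Submodule.mem_span_singleton_self _)
      · refine sup_le le_sup_left ?_
        rw [Submodule.span_singleton_le_iff_mem]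
        have : b = -(V.starProjection (u a)) + u a := by
          rw [hb, starProjection_orthogonal_apply']; abel
        rw [this]
        exact Submodule.add_mem_sup (Submodule.neg_mem _ (Submodule.starProjection_apply_mem _ _))
          (Submodule.mem_span_singleton_self _)
    have hle : ∀ y : E, ‖(V ⊔ Submodule.span ℂ {b}).starProjection y‖ ^ 2
        = ‖V.starProjection y‖ ^ 2 + ‖(Submodule.span ℂ {b}).starProjection y‖ ^ 2 := by
      intro y
      have hort : V ⟂ Submodule.span ℂ {b} := by
        rw [Submodule.isOrtho_iff_le, ← Submodule.le_orthogonal_iff_le_orthogonal,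
          Submodule.span_singleton_le_iff_mem]
        exact hbV
      have hsum : (V ⊔ Submodule.span ℂ {b}).starProjection y
          = V.starProjection y + (Submodule.span ℂ {b}).starProjection y := by
        symm
        refine (Submodule.eq_starProjection_of_mem_of_inner_eq_zero
          (Submodule.add_mem_sup (Submodule.starProjection_apply_mem _ _)
          (Submodule.starProjection_apply_mem _ _)) ?_).symm
        intro w hw
        obtain ⟨p, hp, q, hq, rfl⟩ := Submodule.mem_sup.1 hw
        have e1 : inner ℂ (y - V.starProjection y) p = 0 :=
          Submodule.starProjection_inner_eq_zero _ _ hp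
        have e2 : inner ℂ (y - (Submodule.span ℂ {b}).starProjection y) q = 0 :=
          Submodule.starProjection_inner_eq_zero _ _ hq
        have e3 : inner ℂ ((Submodule.span ℂ {b}).starProjection y) p = 0 :=
          hort.symm.inner_eq (Submodule.starProjection_apply_mem _ _) hp
        have e4 : inner ℂ (V.starProjection y) q = 0 :=
          hort.inner_eq (Submodule.starProjection_apply_mem _ _) hq
        simp only [inner_sub_left, inner_add_left, inner_add_right] at *
        rw [e3, e4, ← sub_eq_zero.1 e1, ← sub_eq_zero.1 e2]; ring
      rw [hsum]
      have := norm_add_sq_eq_norm_sq_add_norm_sq_of_inner_eq_zero (𝕜 := ℂ)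
        (V.starProjection y) ((Submodule.span ℂ {b}).starProjection y)
        (hort.inner_eq (Submodule.starProjection_apply_mem _ _)
          (Submodule.starProjection_apply_mem _ _))
      simpa [sq] using this
    rw [hspan]
    simp_rw [hle]
    rw [Finset.sum_add_distrib, add_comm]
    refine add_le_add ?_ ih
    by_cases hb0 : b = 0
    · simp [hb0, hc a]
    · have hbn : 0 < ‖b‖ := norm_pos_iff.2 hb0
      have h1 : ∀ y, ‖(Submodule.span ℂ {b}).starProjection y‖ ^ 2
          = ‖inner ℂ b y‖ ^ 2 / ‖b‖ ^ 2 := by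
        intro y
        rw [Submodule.starProjection_singleton, norm_smul, norm_div]
        have h2 : ‖((‖b‖ ^ 2 : ℝ) : ℂ)‖ = ‖b‖ ^ 2 := by
          rw [Complex.norm_real, Real.norm_of_nonneg (by positivity)]
        have h3 : ‖inner ℂ b y‖ / ‖b‖ ^ 2 * ‖b‖ = ‖inner ℂ b y‖ / ‖b‖ := by
          field_simp
        exact (congrArg (fun t => (‖inner ℂ b y‖ / t * ‖b‖) ^ 2) h2).trans
          (by rw [h3, div_pow])
      simp_rw [h1]
      rw [← Finset.sum_div, div_le_iff₀ (by positivity)]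
      exact hη a b hbG

/-- Greedy selection: if every row of `g` has average at most `β`, codewords can be chosen one
at a time with small total interference from the earlier ones. -/
lemma exists_greedy_code {W : Type*} [Fintype W] [Nonempty W] (g : W → W → ℝ) (β : ℝ)
    (hg : ∀ w', ∑ w, g w' w ≤ Fintype.card W * β) (N : ℕ) :
    ∃ c : ℕ → W, ∀ x < N, ∑ k ∈ Finset.range x, g (c k) (c x) ≤ x * β := by
  induction N with
  | zero => exact ⟨fun _ => Classical.arbitrary W, by simp⟩
  | succ N ih =>
    obtain ⟨c, hc⟩ := ih
    obtain ⟨w, hw⟩ : ∃ w, ∑ k ∈ Finset.range N, g (c k) w ≤ N * β := by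
      by_contra! h
      have h1 : ∑ _w : W, (N * β : ℝ) < ∑ w, ∑ k ∈ Finset.range N, g (c k) w :=
        Finset.sum_lt_sum_of_nonempty Finset.univ_nonempty fun w _ => h w
      rw [Finset.sum_comm] at h1
      have h2 : ∑ k ∈ Finset.range N, ∑ w, g (c k) w
          ≤ ∑ _k ∈ Finset.range N, (Fintype.card W * β : ℝ) :=
        Finset.sum_le_sum fun k _ => hg _
      simp only [Finset.sum_const, Finset.card_univ, nsmul_eq_mul, Finset.card_range] at h1 h2
      nlinarith
    refine ⟨Function.update c N w, fun x hx => ?_⟩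
    rcases Nat.lt_succ_iff_lt_or_eq.1 hx with h | rfl
    · rw [Function.update_of_ne h.ne]
      refine le_trans (le_of_eq ?_) (hc x h)
      refine Finset.sum_congr rfl fun k hk => ?_
      rw [Function.update_of_ne ((Finset.mem_range.1 hk).trans h).ne]
    · rw [Function.update_self]
      refine le_trans (le_of_eq ?_) hw
      refine Finset.sum_congr rfl fun k hk => ?_
      rw [Function.update_of_ne (Finset.mem_range.1 hk).ne]

end SequentialDecoding

section OneShot

variable {K B : Type*} [Fintype K] [Fintype B]

/-- Vectorisation of a matrix. -/
def vc (X : Matrix K B ℂ) : K × B → ℂ := fun p => X p.1 p.2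

/-- Vectorisation of a matrix, as an element of Euclidean space. -/
noncomputable def vE (X : Matrix K B ℂ) : EuclideanSpace ℂ (K × B) := WithLp.toLp 2 (vc X)

/-- Squared Frobenius norm. -/
noncomputable def nsq (X : Matrix K B ℂ) : ℝ := ∑ k, ∑ b, ‖X k b‖ ^ 2

lemma nsq_nonneg (X : Matrix K B ℂ) : 0 ≤ nsq X := by unfold nsq; positivity

lemma trace_conjTranspose_mul_self_eq (X : Matrix K B ℂ) : (Xᴴ * X).trace = (nsq X : ℂ) := by
  simp only [Matrix.trace, Matrix.diag, Matrix.mul_apply, Matrix.conjTranspose_apply, nsq]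
  push_cast
  rw [Finset.sum_comm]
  refine Finset.sum_congr rfl fun k _ => Finset.sum_congr rfl fun b _ => ?_
  exact Complex.conj_mul' _

lemma trace_mul_conjTranspose_self_eq (X : Matrix K B ℂ) : (X * Xᴴ).trace = (nsq X : ℂ) := by
  rw [Matrix.trace_mul_comm, trace_conjTranspose_mul_self_eq]

lemma nsq_mul_left [DecidableEq K] {U : Matrix K K ℂ} (hU : Uᴴ * U = 1) (X : Matrix K B ℂ) :
    nsq (U * X) = nsq X := by
  have : (nsq (U * X) : ℂ) = nsq X := by
    rw [← trace_conjTranspose_mul_self_eq, ← trace_conjTranspose_mul_self_eq,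
      Matrix.conjTranspose_mul, Matrix.mul_assoc, ← Matrix.mul_assoc Uᴴ, hU, Matrix.one_mul]
  exact_mod_cast this

lemma nsq_mul_right [DecidableEq B] {U : Matrix B B ℂ} (hU : U * Uᴴ = 1) (X : Matrix K B ℂ) :
    nsq (X * U) = nsq X := by
  have : (nsq (X * U) : ℂ) = nsq X := by
    rw [← trace_mul_conjTranspose_self_eq, ← trace_mul_conjTranspose_self_eq,
      Matrix.conjTranspose_mul, Matrix.mul_assoc, ← Matrix.mul_assoc U, hU, Matrix.one_mul]
  exact_mod_cast this

lemma norm_sq_vE (X : Matrix K B ℂ) : ‖vE X‖ ^ 2 = nsq X := by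
  rw [EuclideanSpace.norm_sq_eq, nsq, Fintype.sum_prod_type]
  rfl

lemma inner_vE (X Y : Matrix K B ℂ) : inner ℂ (vE X) (vE Y) = (Xᴴ * Y).trace := by
  rw [EuclideanSpace.inner_eq_star_dotProduct]
  simp only [vE, dotProduct, Fintype.sum_prod_type, vc, Matrix.trace, Matrix.diag,
    Matrix.mul_apply, Matrix.conjTranspose_apply, Pi.star_apply]
  rw [Finset.sum_comm]
  refine Finset.sum_congr rfl fun k _ => Finset.sum_congr rfl fun b _ => mul_comm _ _

lemma exists_eq_vE {K B : Type*} (x : EuclideanSpace ℂ (K × B)) : ∃ X : Matrix K B ℂ, x = vE X :=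
  ⟨Matrix.of fun k b => x (k, b), rfl⟩

lemma vE_sub {K B : Type*} (X Y : Matrix K B ℂ) : vE (X - Y) = vE X - vE Y := rfl

/-- The matrix of an operator on Euclidean space. -/
noncomputable def opMat {O : Type*} [Fintype O] [DecidableEq O]
    (A : EuclideanSpace ℂ O →L[ℂ] EuclideanSpace ℂ O) : Matrix O O ℂ :=
  (Matrix.toEuclideanCLM (n := O) (𝕜 := ℂ)).symm A

lemma trace_opMat_vecMulVec {O : Type*} [Fintype O] [DecidableEq O]
    (A : EuclideanSpace ℂ O →L[ℂ] EuclideanSpace ℂ O) (x : O → ℂ) :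
    ((opMat A)ᴴ * opMat A * Matrix.vecMulVec x (star x)).trace
      = ((‖A (WithLp.toLp 2 x)‖ ^ 2 : ℝ) : ℂ) := by
  have h1 : A (WithLp.toLp 2 x) = WithLp.toLp 2 (opMat A *ᵥ x) := by
    conv_lhs => rw [← (Matrix.toEuclideanCLM (n := O) (𝕜 := ℂ)).apply_symm_apply A]
    exact Matrix.toEuclideanCLM_toLp _ _
  rw [Matrix.mul_vecMulVec, Matrix.trace_vecMulVec, h1, EuclideanSpace.norm_sq_eq,
    ← Matrix.mulVec_mulVec, dotProduct_comm, Matrix.dotProduct_mulVec, ← Matrix.star_mulVec]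
  push_cast
  refine Finset.sum_congr rfl fun i _ => ?_
  exact Complex.conj_mul' _

lemma sum_norm_sq_eq_of_ensemble [DecidableEq K] [DecidableEq B] {S Z : Type*} [Fintype S] [Fintype Z]
    (x : S → Matrix K B ℂ) (v : Z → Matrix K B ℂ) (μ : Z → ℝ)
    (h : ∑ s, vecMulVec (vc (x s)) (star (vc (x s)))
      = ∑ z, (μ z : ℂ) • vecMulVec (vc (v z)) (star (vc (v z))))
    (A : EuclideanSpace ℂ (K × B) →L[ℂ] EuclideanSpace ℂ (K × B)) :
    ∑ s, ‖A (vE (x s))‖ ^ 2 = ∑ z, μ z * ‖A (vE (v z))‖ ^ 2 := by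
  have h2 := congrArg (fun M => ((opMat A)ᴴ * opMat A * M).trace) h
  simp only [Matrix.mul_sum, Matrix.trace_sum, Matrix.mul_smul, Matrix.trace_smul,
    trace_opMat_vecMulVec, smul_eq_mul] at h2
  exact_mod_cast h2

variable [DecidableEq K]

/-- Vectors whose first factor lies in the span of the eigenvectors with eigenvalue `< c`. -/
noncomputable def lowSpace (B : Type*) [Fintype B] {σ : Matrix K K ℂ} (h : σ.IsHermitian)
    (c : ℝ) : Submodule ℂ (EuclideanSpace ℂ (K × B)) where
  carrier := {x | ∀ e, c ≤ h.eigenvalues e → ∀ b,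
    ∑ k, star ((h.eigenvectorUnitary : Matrix K K ℂ) k e) * x (k, b) = 0}
  zero_mem' := by intro e _ b; simp
  add_mem' := by
    intro x y hx hy e he b
    have h1 := hx e he b
    have h2 := hy e he b
    simp only [PiLp.add_apply, mul_add, Finset.sum_add_distrib, h1, h2, add_zero]
  smul_mem' := by
    intro r x hx e he b
    have h1 := hx e he b
    simp only [PiLp.smul_apply, smul_eq_mul, mul_left_comm _ r, ← Finset.mul_sum, h1, mul_zero]

lemma lowSpace_mono {σ : Matrix K K ℂ} (h : σ.IsHermitian) : Monotone (lowSpace B h) :=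
  fun _ _ hcc _ hx e he b => hx e (hcc.trans he) b

lemma vE_mem_lowSpace {σ : Matrix K K ℂ} (h : σ.IsHermitian) (c : ℝ) (X : Matrix K B ℂ) :
    vE X ∈ lowSpace B h c ↔ ∀ e, c ≤ h.eigenvalues e → ∀ b,
      ((h.eigenvectorUnitary : Matrix K K ℂ)ᴴ * X) e b = 0 := by
  rfl

lemma eigU_mul_conjTranspose {σ : Matrix K K ℂ} (h : σ.IsHermitian) :
    (h.eigenvectorUnitary : Matrix K K ℂ) * (h.eigenvectorUnitary : Matrix K K ℂ)ᴴ = 1 :=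
  Unitary.coe_mul_star_self _

lemma eigU_conjTranspose_mul {σ : Matrix K K ℂ} (h : σ.IsHermitian) :
    (h.eigenvectorUnitary : Matrix K K ℂ)ᴴ * (h.eigenvectorUnitary : Matrix K K ℂ) = 1 :=
  Unitary.coe_star_mul_self _

lemma spectral_eq {σ : Matrix K K ℂ} (h : σ.IsHermitian) :
    σ = (h.eigenvectorUnitary : Matrix K K ℂ) *
      Matrix.diagonal (fun e => (h.eigenvalues e : ℂ)) *
        (h.eigenvectorUnitary : Matrix K K ℂ)ᴴ := by
  conv_lhs => rw [h.spectral_theorem]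
  rfl

lemma trace_form_eq {σ : Matrix K K ℂ} (h : σ.IsHermitian) (X : Matrix K B ℂ) :
    ((Xᴴ * σ * X).trace).re = ∑ e, h.eigenvalues e *
      ∑ b, ‖((h.eigenvectorUnitary : Matrix K K ℂ)ᴴ * X) e b‖ ^ 2 := by
  set Y := (h.eigenvectorUnitary : Matrix K K ℂ)ᴴ * X with hY
  have h1 : Xᴴ * σ * X = Yᴴ * (Matrix.diagonal (fun e => (h.eigenvalues e : ℂ)) * Y) := by
    conv_lhs => rw [spectral_eq h]
    simp only [hY, Matrix.conjTranspose_mul, Matrix.conjTranspose_conjTranspose, Matrix.mul_assoc]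
  have h2 : (Xᴴ * σ * X).trace = ((∑ e, h.eigenvalues e * ∑ b, ‖Y e b‖ ^ 2 : ℝ) : ℂ) := by
    rw [h1]
    simp only [Matrix.trace, Matrix.diag, Matrix.mul_apply (M := Yᴴ), Matrix.diagonal_mul,
      Matrix.conjTranspose_apply]
    push_cast
    rw [Finset.sum_comm]
    refine Finset.sum_congr rfl fun e _ => ?_
    rw [Finset.mul_sum]
    refine Finset.sum_congr rfl fun b _ => ?_
    rw [← Complex.conj_mul']
    simp only [RCLike.star_def]
    ring
  rw [h2, Complex.ofReal_re]

lemma trace_form_le_of_mem_lowSpace {σ : Matrix K K ℂ} (h : σ.IsHermitian) (c : ℝ)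
    (X : Matrix K B ℂ) (hX : vE X ∈ lowSpace B h c) :
    ((Xᴴ * σ * X).trace).re ≤ c * nsq X := by
  rw [trace_form_eq h, ← nsq_mul_left (U := (h.eigenvectorUnitary : Matrix K K ℂ)ᴴ)
    (by rw [Matrix.conjTranspose_conjTranspose]; exact eigU_mul_conjTranspose h) X, nsq,
    Finset.mul_sum]
  refine Finset.sum_le_sum fun e _ => ?_
  by_cases he : c ≤ h.eigenvalues e
  · have := (vE_mem_lowSpace h c X).1 hX e he
    simp [this]
  · exact mul_le_mul_of_nonneg_right (not_le.1 he).le (by positivity)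

/-- Spectral projection onto eigenvalues `< c`. -/
noncomputable def lowProj {σ : Matrix K K ℂ} (h : σ.IsHermitian) (c : ℝ) : Matrix K K ℂ :=
  (h.eigenvectorUnitary : Matrix K K ℂ) *
    Matrix.diagonal (fun e => if c ≤ h.eigenvalues e then 0 else 1) *
      (h.eigenvectorUnitary : Matrix K K ℂ)ᴴ

lemma eigU_mul_lowProj {B : Type*} {σ : Matrix K K ℂ} (h : σ.IsHermitian) (c : ℝ) (X : Matrix K B ℂ)
    (e : K) (b : B) :
    ((h.eigenvectorUnitary : Matrix K K ℂ)ᴴ * (lowProj h c * X)) e b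
      = if c ≤ h.eigenvalues e then 0
        else ((h.eigenvectorUnitary : Matrix K K ℂ)ᴴ * X) e b := by
  have : (h.eigenvectorUnitary : Matrix K K ℂ)ᴴ * (lowProj h c * X)
      = Matrix.diagonal (fun e => if c ≤ h.eigenvalues e then (0 : ℂ) else 1) *
        ((h.eigenvectorUnitary : Matrix K K ℂ)ᴴ * X) := by
    simp only [lowProj, Matrix.mul_assoc]
    rw [← Matrix.mul_assoc, eigU_conjTranspose_mul, Matrix.one_mul]
  rw [this, Matrix.diagonal_mul]
  split_ifs <;> simp

lemma lowProj_mem {σ : Matrix K K ℂ} (h : σ.IsHermitian) (c : ℝ) (X : Matrix K B ℂ) :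
    vE (lowProj h c * X) ∈ lowSpace B h c := by
  rw [vE_mem_lowSpace]
  intro e he b
  rw [eigU_mul_lowProj, if_pos he]

lemma nsq_sub_lowProj {σ : Matrix K K ℂ} (h : σ.IsHermitian) (c : ℝ) (X : Matrix K B ℂ) :
    nsq (X - lowProj h c * X) = ∑ e with c ≤ h.eigenvalues e,
      (((h.eigenvectorUnitary : Matrix K K ℂ)ᴴ * (X * Xᴴ) *
        (h.eigenvectorUnitary : Matrix K K ℂ)) e e).re := by
  rw [← nsq_mul_left (U := (h.eigenvectorUnitary : Matrix K K ℂ)ᴴ)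
    (by rw [Matrix.conjTranspose_conjTranspose]; exact eigU_mul_conjTranspose h), nsq,
    Finset.sum_filter]
  refine Finset.sum_congr rfl fun e _ => ?_
  rw [Matrix.mul_sub]
  simp only [Matrix.sub_apply, eigU_mul_lowProj]
  split_ifs
  · have : (h.eigenvectorUnitary : Matrix K K ℂ)ᴴ * (X * Xᴴ) *
        (h.eigenvectorUnitary : Matrix K K ℂ) = ((h.eigenvectorUnitary : Matrix K K ℂ)ᴴ * X) *
        ((h.eigenvectorUnitary : Matrix K K ℂ)ᴴ * X)ᴴ := by
      simp [Matrix.conjTranspose_mul, Matrix.mul_assoc]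
    rw [this, Matrix.mul_apply, Complex.re_sum]
    refine Finset.sum_congr rfl fun b _ => ?_
    rw [Matrix.conjTranspose_apply, RCLike.star_def, Complex.mul_conj', sub_zero]
    norm_cast
  · simp

theorem one_shot_code {ι S W Z : Type*} [Fintype ι] [Fintype S] [Fintype W] [Fintype Z]
    [DecidableEq ι] [DecidableEq Z] [DecidableEq B] [Nonempty W]
    (x : W → ι → S → Matrix K B ℂ) (σ : ι → Matrix K K ℂ) (v : W → ι → Z → Matrix K B ℂ)
    (μ : ι → Z → ℝ) (A : ι → Finset Z) (c : ι → ℝ) (D ε₁ ε₂ : ℝ)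
    (hμ : ∀ i z, 0 ≤ μ i z) (hc : ∀ i, 0 < c i) (hD : 0 < D)
    (hσ : ∀ i, (σ i).trace = 1)
    (hmarg : ∀ w i, ∑ s, x w i s * (x w i s)ᴴ = σ i)
    (hens : ∀ w i, ∑ s, vecMulVec (vc (x w i s)) (star (vc (x w i s)))
      = ∑ z, (μ i z : ℂ) • vecMulVec (vc (v w i z)) (star (vc (v w i z))))
    (hε₁ : ∀ w i, ∑ z ∈ (A i)ᶜ, μ i z * nsq (v w i z) ≤ ε₁)
    (hε₂ : ∀ i (Y : Matrix K K ℂ), Yᴴ * Y = 1 → ∀ G : Finset K,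
      (G.card : ℝ) * c i ≤ Fintype.card ι → ∑ e ∈ G, ((Yᴴ * σ i * Y) e e).re ≤ ε₂)
    (htw : ∀ i X, ∑ w, ∑ s, ‖(Xᴴ * x w i s).trace‖ ^ 2
      ≤ Fintype.card W / D * ((Xᴴ * σ i * X).trace).re) (N : ℕ) :
    ∃ (w : Fin N → W) (F : Fin N → Matrix (K × B) (K × B) ℂ),
      (∀ α, (F α).PosSemidef) ∧ (1 - ∑ α, F α).PosSemidef ∧
      ∀ α i, 1 - 4 * (ε₁ + ε₂ + α * (D⁻¹ * ∑ i, c i * (A i).card)) ≤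
          ∑ s, ((F α * vecMulVec (vc (x (w α) i s)) (star (vc (x (w α) i s)))).trace).re ∧
        ∑ s, ((F α * vecMulVec (vc (x (w α) i s)) (star (vc (x (w α) i s)))).trace).re ≤ 1 := by
  classical
  have hσp : ∀ i, (σ i).PosSemidef := by
    intro i
    rw [← hmarg (Classical.arbitrary W) i]
    exact Matrix.posSemidef_sum _ fun s _ => Matrix.posSemidef_self_mul_conjTranspose _
  set tot := ∑ i, σ i with htot
  have htp : tot.PosSemidef := Matrix.posSemidef_sum _ fun i _ => hσp i
  have h := htp.isHermitian
  have hev : ∀ e, 0 ≤ h.eigenvalues e := fun e => htp.eigenvalues_nonneg e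
  have hcW : (0 : ℝ) < Fintype.card W := by exact_mod_cast Fintype.card_pos
  set r : ℝ := Fintype.card W / D with hr
  have hr0 : 0 < r := div_pos hcW hD
  -- the projections
  let V : W → Submodule ℂ (EuclideanSpace ℂ (K × B)) := fun w =>
    Submodule.span ℂ ((fun j : ι × Z => vE (lowProj h (c j.1) * v w j.1 j.2)) ''
      ((Finset.univ.filter fun j : ι × Z => j.2 ∈ A j.1 : Finset (ι × Z)) : Set (ι × Z)))
  have hnx : ∀ w i, ∑ s, ‖vE (x w i s)‖ ^ 2 = 1 := by
    intro w i
    have h1 : ((∑ s, ‖vE (x w i s)‖ ^ 2 : ℝ) : ℂ) = 1 := by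
      rw [← hσ i, ← hmarg w i, Matrix.trace_sum]
      push_cast
      refine Finset.sum_congr rfl fun s _ => ?_
      rw [trace_mul_conjTranspose_self_eq, ← norm_sq_vE]; push_cast; rfl
    exact_mod_cast h1
  have hacc : ∀ w i, ∑ s, ‖(V w)ᗮ.starProjection (vE (x w i s))‖ ^ 2 ≤ ε₁ + ε₂ := by
    intro w i
    rw [sum_norm_sq_eq_of_ensemble _ _ _ (hens w i), ← Finset.sum_compl_add_sum (A i)]
    refine add_le_add (le_trans (Finset.sum_le_sum fun z _ => ?_) (hε₁ w i)) ?_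
    · refine mul_le_mul_of_nonneg_left ?_ (hμ i z)
      rw [← norm_sq_vE]
      exact pow_le_pow_left₀ (norm_nonneg _) (Submodule.norm_starProjection_apply_le _ _) 2
    · have h1 : ∀ z ∈ A i, μ i z * ‖(V w)ᗮ.starProjection (vE (v w i z))‖ ^ 2
          ≤ μ i z * nsq (v w i z - lowProj h (c i) * v w i z) := by
        intro z hz
        refine mul_le_mul_of_nonneg_left ?_ (hμ i z)
        have hmem : vE (lowProj h (c i) * v w i z) ∈ V w :=
          Submodule.subset_span ⟨(i, z), by simpa using hz, rfl⟩
        have h2 : (V w)ᗮ.starProjection (vE (v w i z))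
            = (V w)ᗮ.starProjection (vE (v w i z - lowProj h (c i) * v w i z)) := by
          rw [vE_sub, map_sub, starProjection_orthogonal_apply' _ (vE (lowProj h (c i) * v w i z)),
            Submodule.starProjection_eq_self_iff.2 hmem, sub_self, sub_zero]
        rw [h2, ← norm_sq_vE]
        exact pow_le_pow_left₀ (norm_nonneg _) (Submodule.norm_starProjection_apply_le _ _) 2
      refine (Finset.sum_le_sum h1).trans ?_
      have h3 : ∑ z ∈ A i, μ i z * nsq (v w i z - lowProj h (c i) * v w i z)
          ≤ ∑ z, μ i z * nsq (v w i z - lowProj h (c i) * v w i z) :=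
        Finset.sum_le_sum_of_subset_of_nonneg (Finset.subset_univ _)
          fun z _ _ => mul_nonneg (hμ i z) (nsq_nonneg _)
      refine h3.trans ?_
      have h4 : ∑ z, μ i z * nsq (v w i z - lowProj h (c i) * v w i z)
          = ∑ s, nsq (x w i s - lowProj h (c i) * x w i s) := by
        simp_rw [nsq_sub_lowProj]
        simp_rw [Finset.mul_sum]
        rw [Finset.sum_comm, Finset.sum_comm (s := Finset.univ (α := S))]
        refine Finset.sum_congr rfl fun e _ => ?_
        have h5 : ∑ s, x w i s * (x w i s)ᴴ = ∑ z, (μ i z : ℂ) • (v w i z * (v w i z)ᴴ) := by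
          ext k k'
          have h6 := fun b : B => congrFun (congrFun (hens w i) (k, b)) (k', b)
          simp only [Matrix.sum_apply, Matrix.smul_apply, vecMulVec_apply, Pi.star_apply, vc,
            smul_eq_mul] at h6
          simp only [Matrix.sum_apply, Matrix.smul_apply, Matrix.mul_apply,
            Matrix.conjTranspose_apply, smul_eq_mul, Finset.mul_sum]
          rw [Finset.sum_comm, Finset.sum_comm (s := Finset.univ (α := Z))]
          exact Finset.sum_congr rfl fun b _ => h6 b
        have h7 := congrArg (fun M => (((h.eigenvectorUnitary : Matrix K K ℂ)ᴴ * M *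
          (h.eigenvectorUnitary : Matrix K K ℂ)) e e).re) h5
        simp only [Matrix.mul_sum, Matrix.sum_mul, Matrix.sum_apply, Matrix.mul_smul,
          Matrix.smul_mul, Matrix.smul_apply, smul_eq_mul, Complex.re_sum,
          Complex.re_ofReal_mul] at h7
        exact h7.symm
      rw [h4]
      simp_rw [nsq_sub_lowProj]
      rw [Finset.sum_comm]
      have h8 : ∀ e, ∑ s, (((h.eigenvectorUnitary : Matrix K K ℂ)ᴴ * (x w i s * (x w i s)ᴴ) *
          (h.eigenvectorUnitary : Matrix K K ℂ)) e e).re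
          = (((h.eigenvectorUnitary : Matrix K K ℂ)ᴴ * σ i *
            (h.eigenvectorUnitary : Matrix K K ℂ)) e e).re := by
        intro e
        rw [← hmarg w i]
        simp only [Matrix.mul_sum, Matrix.sum_mul, Matrix.sum_apply, Complex.re_sum]
      simp_rw [h8]
      refine hε₂ i _ (eigU_conjTranspose_mul h) _ ?_
      have h9 : ∑ e, h.eigenvalues e = Fintype.card ι := by
        have h10 : (∑ e, (h.eigenvalues e : ℂ)) = (Fintype.card ι : ℂ) := by
          have := h.trace_eq_sum_eigenvalues
          simp only [Complex.coe_algebraMap] at this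
          rw [← this, htot, Matrix.trace_sum]
          simp [hσ]
        exact_mod_cast h10
      rw [← h9, ← nsmul_eq_mul]
      exact (Finset.card_nsmul_le_sum _ _ _ fun e he => (Finset.mem_filter.1 he).2).trans
        (Finset.sum_le_sum_of_subset_of_nonneg (Finset.subset_univ _) fun e _ _ => hev e)
  let g : W → W → ℝ := fun w' w => ∑ i, ∑ s, ‖(V w').starProjection (vE (x w i s))‖ ^ 2
  have hg0 : ∀ w' w i, ∑ s, ‖(V w').starProjection (vE (x w i s))‖ ^ 2 ≤ g w' w := fun w' w i =>
    Finset.single_le_sum (f := fun i => ∑ s, ‖(V w').starProjection (vE (x w i s))‖ ^ 2)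
      (fun i _ => by positivity) (Finset.mem_univ i)
  have hg : ∀ w', ∑ w, g w' w ≤ Fintype.card W * (D⁻¹ * ∑ i, c i * (A i).card) := by
    intro w'
    have h1 := sum_norm_sq_starProjection_span_le
      (fun l : W × ι × S => vE (x l.1 l.2.1 l.2.2))
      (fun j : ι × Z => vE (lowProj h (c j.1) * v w' j.1 j.2)) (fun j => r * c j.1)
      (fun t => lowSpace B h (t / r))
      (fun a b hab => lowSpace_mono h (by gcongr))
      (fun j => mul_nonneg hr0.le (hc _).le)
      (fun j => by
        have : r * c j.1 / r = c j.1 := by field_simp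
        simp only [this]
        exact lowProj_mem h _ _)
      (fun j y hy => by
        have : r * c j.1 / r = c j.1 := by field_simp
        simp only [this] at hy
        obtain ⟨X, rfl⟩ := exists_eq_vE y
        simp only [inner_vE, norm_sq_vE, Fintype.sum_prod_type]
        rw [Finset.sum_comm]
        refine (Finset.sum_le_sum fun i _ => htw i X).trans ?_
        rw [← Finset.mul_sum, mul_assoc]
        refine mul_le_mul_of_nonneg_left ?_ hr0.le
        have h2 : ∑ i, ((Xᴴ * σ i * X).trace).re = ((Xᴴ * tot * X).trace).re := by
          rw [htot]
          simp only [Matrix.mul_sum, Matrix.sum_mul, Matrix.trace_sum, Complex.re_sum]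
        rw [h2]
        exact trace_form_le_of_mem_lowSpace h _ X hy)
      (Finset.univ.filter fun j : ι × Z => j.2 ∈ A j.1)
    simp only [Fintype.sum_prod_type] at h1
    refine h1.trans_eq ?_
    rw [Finset.sum_filter, Fintype.sum_prod_type, ← mul_assoc, ← div_eq_mul_inv, ← hr,
      Finset.mul_sum]
    refine Finset.sum_congr rfl fun i _ => ?_
    rw [← Finset.sum_filter]
    simp
    ring
  obtain ⟨cw, hcw⟩ := exists_greedy_code g _ hg N
  let VV : ℕ → Submodule ℂ (EuclideanSpace ℂ (K × B)) := fun k => V (cw k)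
  refine ⟨fun α => cw α, fun α => (opMat (seqDec VV α))ᴴ * opMat (seqDec VV α),
    fun α => Matrix.posSemidef_conjTranspose_mul_self _, ?_, ?_⟩
  · rw [Matrix.posSemidef_iff_dotProduct_mulVec]
    have hherm : (1 - ∑ α : Fin N, (opMat (seqDec VV α))ᴴ * opMat (seqDec VV α)).IsHermitian := by
      refine Matrix.isHermitian_one.sub ?_
      exact (Matrix.posSemidef_sum _ fun α _ =>
        Matrix.posSemidef_conjTranspose_mul_self _).isHermitian
    refine ⟨hherm, fun y => ?_⟩
    have h1 : ∀ M : Matrix (K × B) (K × B) ℂ, star y ⬝ᵥ (M *ᵥ y)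
        = (M * vecMulVec y (star y)).trace := by
      intro M
      rw [Matrix.mul_vecMulVec, Matrix.trace_vecMulVec, dotProduct_comm]
    rw [h1, Matrix.sub_mul, Matrix.trace_sub, Matrix.sum_mul, Matrix.trace_sum, Matrix.one_mul,
      Matrix.trace_vecMulVec]
    simp only [trace_opMat_vecMulVec]
    have h2 : y ⬝ᵥ star y = ((‖(WithLp.toLp 2 y : EuclideanSpace ℂ (K × B))‖ ^ 2 : ℝ) : ℂ) := by
      rw [EuclideanSpace.norm_sq_eq]
      push_cast
      refine Finset.sum_congr rfl fun i _ => ?_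
      exact Complex.mul_conj' _
    rw [h2, ← Complex.ofReal_sum, ← Complex.ofReal_sub]
    have h3 := sum_norm_sq_seqDec_le VV (WithLp.toLp 2 y) N
    rw [Finset.sum_range] at h3
    exact_mod_cast sub_nonneg.2 h3
  · intro α i
    simp only [trace_opMat_vecMulVec, Complex.ofReal_re]
    have hx := hnx (cw α) i
    constructor
    · have h1 : ∑ s, (‖vE (x (cw α) i s)‖ ^ 2 - ‖seqDec VV α (vE (x (cw α) i s))‖ ^ 2)
          ≤ ∑ s, 4 * (‖(V (cw α))ᗮ.starProjection (vE (x (cw α) i s))‖ ^ 2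
            + ∑ k ∈ Finset.range α, ‖(V (cw k)).starProjection (vE (x (cw α) i s))‖ ^ 2) :=
        Finset.sum_le_sum fun s _ => norm_sq_sub_seqDec_le VV _ α
      rw [Finset.sum_sub_distrib, hx, ← Finset.mul_sum, Finset.sum_add_distrib,
        Finset.sum_comm] at h1
      have h2 := hacc (cw α) i
      have h3 : ∑ k ∈ Finset.range α, ∑ s, ‖(V (cw k)).starProjection (vE (x (cw α) i s))‖ ^ 2
          ≤ ∑ k ∈ Finset.range α, g (cw k) (cw α) :=
        Finset.sum_le_sum fun k _ => hg0 _ _ _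
      have h4 := hcw α α.2
      change 1 - ∑ s, ‖seqDec VV α (vE (x (cw α) i s))‖ ^ 2 ≤ _ at h1
      change _ ≤ ∑ s, ‖seqDec VV α (vE (x (cw α) i s))‖ ^ 2
      linarith
    · rw [← hx]
      exact Finset.sum_le_sum fun s _ => norm_seqDec_le VV _ α

end OneShot

lemma sum_pi_prod {R ι Z : Type*} [CommSemiring R] [Fintype ι] [DecidableEq ι] [Fintype Z]
    (f : ι → Z → R) : ∑ z : ι → Z, ∏ k, f k (z k) = ∏ k, ∑ z, f k z := by
  rw [Finset.prod_univ_sum, Fintype.piFinset_univ]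

section Tails

variable {Z : Type*} [Fintype Z]

lemma exists_expMoment_lt_one (q a : Z → ℝ) (hq1 : ∑ z, q z = 1) (t : ℝ)
    (ht : ∑ z, q z * a z < t) : ∃ s > 0, ∑ z, q z * Real.exp (s * (a z - t)) < 1 := by
  set f : ℝ → ℝ := fun s => ∑ z, q z * Real.exp (s * (a z - t)) with hf
  have h0 : f 0 = 1 := by simp [hf, hq1]
  have hd : HasDerivAt f (∑ z, q z * (a z - t)) 0 := by
    have : ∀ z ∈ Finset.univ (α := Z),
        HasDerivAt (fun s => q z * Real.exp (s * (a z - t))) (q z * (a z - t)) 0 := by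
      intro z _
      have h1 := (((hasDerivAt_id (0 : ℝ)).mul_const (a z - t)).exp).const_mul (q z)
      simpa using h1
    exact HasDerivAt.fun_sum this
  have hneg : ∑ z, q z * (a z - t) < 0 := by
    simp only [mul_sub, Finset.sum_sub_distrib, ← Finset.sum_mul, hq1]
    linarith
  have h1 := hasDerivAt_iff_tendsto_slope.1 hd
  have h2 := (h1.mono_left (nhdsWithin_mono 0 (s := Set.Ioi 0)
    fun x hx => ne_of_gt hx)).eventually (gt_mem_nhds hneg)
  obtain ⟨s, hs, hs0⟩ := (h2.and self_mem_nhdsWithin).exists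
  refine ⟨s, hs0, ?_⟩
  have hs0' : (0 : ℝ) < s := hs0
  rw [slope_def_field, h0, sub_zero, div_lt_iff₀ hs0', zero_mul] at hs
  linarith

/-- Chernoff bound for sums of i.i.d. variables on a finite set. -/
lemma chernoff_bound (q a : Z → ℝ) (hq : ∀ z, 0 ≤ q z) (hq1 : ∑ z, q z = 1) (t : ℝ)
    (ht : ∑ z, q z * a z < t) : ∃ c > 0, ∀ {ι : Type} [Fintype ι] [DecidableEq ι]
      (s : Finset (ι → Z)),
      (∀ z ∈ s, (∏ k, q (z k) ≠ 0) → Fintype.card ι * t ≤ ∑ k, a (z k)) →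
      ∑ z ∈ s, ∏ k, q (z k) ≤ Real.exp (-(c * Fintype.card ι)) := by
  obtain ⟨s, hs, h⟩ := exists_expMoment_lt_one q a hq1 t ht
  set f := ∑ z, q z * Real.exp (s * (a z - t)) with hf
  have hf0 : 0 < f := by
    obtain ⟨z, hz⟩ : ∃ z, q z ≠ 0 := by
      by_contra! hcon
      simp [hcon] at hq1
    exact Finset.sum_pos' (fun z _ => mul_nonneg (hq z) (Real.exp_pos _).le)
      ⟨z, Finset.mem_univ _, mul_pos (lt_of_le_of_ne (hq z) hz.symm) (Real.exp_pos _)⟩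
  refine ⟨-Real.log f, neg_pos.2 (Real.log_neg hf0 h), fun {ι} _ _ S hS => ?_⟩
  have h1 : ∀ z ∈ S, ∏ k, q (z k) ≤ ∏ k, (q (z k) * Real.exp (s * (a (z k) - t))) := by
    intro z hz
    rw [Finset.prod_mul_distrib, ← Real.exp_sum]
    by_cases h0 : ∏ k, q (z k) = 0
    · simp [h0]
    · refine le_mul_of_one_le_right (Finset.prod_nonneg fun k _ => hq _) (Real.one_le_exp ?_)
      rw [← Finset.mul_sum, Finset.sum_sub_distrib]
      have := hS z hz h0
      refine mul_nonneg hs.le ?_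
      simpa using this
  calc ∑ z ∈ S, ∏ k, q (z k) ≤ ∑ z ∈ S, ∏ k, (q (z k) * Real.exp (s * (a (z k) - t))) :=
        Finset.sum_le_sum h1
    _ ≤ ∑ z : ι → Z, ∏ k, (q (z k) * Real.exp (s * (a (z k) - t))) :=
        Finset.sum_le_sum_of_subset_of_nonneg (Finset.subset_univ _) fun z _ _ =>
          Finset.prod_nonneg fun k _ => mul_nonneg (hq _) (Real.exp_pos _).le
    _ = f ^ Fintype.card ι := by
        rw [sum_pi_prod (fun (_ : ι) z => q z * Real.exp (s * (a z - t))), Finset.prod_const,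
          Finset.card_univ]
    _ = Real.exp (-(-Real.log f * Fintype.card ι)) := by
        rw [neg_mul, neg_neg, mul_comm, Real.exp_nat_mul, Real.exp_log hf0]

/-- Entropy typicality: the tails of the log-likelihood decay exponentially. -/
lemma entropy_tails (q : Z → ℝ) (hq : ∀ z, 0 ≤ q z) (hq1 : ∑ z, q z = 1) {δ : ℝ} (hδ : 0 < δ) :
    ∃ c > 0, ∀ {ι : Type} [Fintype ι] [DecidableEq ι] (s : Finset (ι → Z)),
      ((∀ z ∈ s, ∏ k, q (z k) ≤
          Real.exp (-(Fintype.card ι * (∑ z, Real.negMulLog (q z) + δ)))) →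
        ∑ z ∈ s, ∏ k, q (z k) ≤ Real.exp (-(c * Fintype.card ι))) ∧
      ((∀ z ∈ s, Real.exp (-(Fintype.card ι * (∑ z, Real.negMulLog (q z) - δ))) ≤
          ∏ k, q (z k)) →
        ∑ z ∈ s, ∏ k, q (z k) ≤ Real.exp (-(c * Fintype.card ι))) := by
  set h := ∑ z, Real.negMulLog (q z) with hh
  obtain ⟨c₁, hc₁, H₁⟩ := chernoff_bound q (fun z => -Real.log (q z)) hq hq1 (h + δ) (by
    have : ∑ z, q z * -Real.log (q z) = h :=
      Finset.sum_congr rfl fun z _ => by rw [Real.negMulLog]; ring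
    linarith)
  obtain ⟨c₂, hc₂, H₂⟩ := chernoff_bound q (fun z => Real.log (q z)) hq hq1 (-(h - δ)) (by
    have : ∑ z, q z * Real.log (q z) = -h := by
      rw [hh, ← Finset.sum_neg_distrib]
      exact Finset.sum_congr rfl fun z _ => by rw [Real.negMulLog]; ring
    linarith)
  refine ⟨min c₁ c₂, lt_min hc₁ hc₂, fun {ι} _ _ s => ⟨fun hs => ?_, fun hs => ?_⟩⟩
  · refine (H₁ s fun z hz h0 => ?_).trans (Real.exp_le_exp.2 ?_)
    · have h1 := Real.log_le_log (lt_of_le_of_ne (Finset.prod_nonneg fun k _ => hq (z k)) h0.symm)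
        (hs z hz)
      rw [Real.log_exp, Real.log_prod fun k hk => (Finset.prod_ne_zero_iff.1 h0) k hk] at h1
      rw [Finset.sum_neg_distrib]
      linarith
    · gcongr; exact min_le_left _ _
  · refine (H₂ s fun z hz h0 => ?_).trans (Real.exp_le_exp.2 ?_)
    · have h1 := Real.log_le_log (Real.exp_pos _) (hs z hz)
      rw [Real.log_exp, Real.log_prod fun k hk => (Finset.prod_ne_zero_iff.1 h0) k hk] at h1
      linarith
    · gcongr; exact min_le_right _ _

end Tails

section DesignCode

variable {Y X : Type*} [Fintype Y] [Fintype X] [DecidableEq X]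

lemma vecMulVec_mulVec_star {m n : Type*} [Fintype n] (M : Matrix m n ℂ) (v : n → ℂ) :
    vecMulVec (M *ᵥ v) (star (M *ᵥ v)) = M * vecMulVec v (star v) * Mᴴ := by
  rw [Matrix.star_mulVec, Matrix.mul_vecMulVec, Matrix.vecMulVec_mul]

lemma vc_mul {Y X X' : Type*} [Fintype Y] [Fintype X] [DecidableEq Y] (A : Matrix Y X ℂ) (B : Matrix X X' ℂ) :
    vc (A * B) = (Matrix.of fun (p : Y × X') (q : Y × X) =>
      if p.1 = q.1 then B q.2 p.2 else 0) *ᵥ vc A := by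
  ext ⟨k, b⟩
  simp [vc, Matrix.mul_apply, Matrix.mulVec, dotProduct, Fintype.sum_prod_type, mul_comm]

lemma ensemble_mul_right {Y X S Z : Type*} [Fintype Y] [Fintype X] [DecidableEq Y] [Fintype S]
    [Fintype Z]
    {x : S → Matrix Y X ℂ} {v : Z → Matrix Y X ℂ} {μ : Z → ℝ}
    (h : ∑ s, vecMulVec (vc (x s)) (star (vc (x s)))
      = ∑ z, (μ z : ℂ) • vecMulVec (vc (v z)) (star (vc (v z)))) {X' : Type*} (B : Matrix X X' ℂ) :
    ∑ s, vecMulVec (vc (x s * B)) (star (vc (x s * B)))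
      = ∑ z, (μ z : ℂ) • vecMulVec (vc (v z * B)) (star (vc (v z * B))) := by
  simp only [vc_mul, vecMulVec_mulVec_star]
  rw [← Matrix.sum_mul, ← Matrix.mul_sum, h]
  simp [Matrix.mul_sum, Matrix.sum_mul]

lemma re_conj_diagonal_apply {S : Type*} [Fintype S] (T : S → Matrix Y X ℂ) (d : X → ℝ)
    (Q : Matrix Y Y ℂ) (e : Y) :
    ((Qᴴ * (∑ s, T s * diagonal (fun a => (d a : ℂ)) * (T s)ᴴ) * Q) e e).re
      = ∑ s, ∑ a, d a * ‖(Qᴴ * T s) e a‖ ^ 2 := by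
  simp only [Matrix.mul_sum, Matrix.sum_mul, Matrix.sum_apply, Complex.re_sum]
  refine Finset.sum_congr rfl fun s _ => ?_
  have : Qᴴ * (T s * diagonal (fun a => (d a : ℂ)) * (T s)ᴴ) * Q
      = (Qᴴ * T s) * diagonal (fun a => (d a : ℂ)) * (Qᴴ * T s)ᴴ := by
    simp [Matrix.conjTranspose_mul, Matrix.mul_assoc]
  rw [this, Matrix.mul_apply, Complex.re_sum]
  refine Finset.sum_congr rfl fun a _ => ?_
  rw [Matrix.mul_diagonal, Matrix.conjTranspose_apply, RCLike.star_def,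
    mul_right_comm, Complex.mul_conj']
  norm_cast
  ring

lemma trace_conj_diagonal {S B : Type*} [Fintype S] [Fintype B] (T : S → Matrix Y X ℂ) (d : X → ℝ)
    (Q : Matrix Y B ℂ) :
    ((Qᴴ * (∑ s, T s * diagonal (fun a => (d a : ℂ)) * (T s)ᴴ) * Q).trace).re
      = ∑ s, ∑ b, ∑ a, d a * ‖(Qᴴ * T s) b a‖ ^ 2 := by
  simp only [Matrix.mul_sum, Matrix.sum_mul, Matrix.trace_sum, Complex.re_sum]
  refine Finset.sum_congr rfl fun s _ => ?_
  have : Qᴴ * (T s * diagonal (fun a => (d a : ℂ)) * (T s)ᴴ) * Q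
      = (Qᴴ * T s) * diagonal (fun a => (d a : ℂ)) * (Qᴴ * T s)ᴴ := by
    simp [Matrix.conjTranspose_mul, Matrix.mul_assoc]
  rw [this, Matrix.trace, Complex.re_sum]
  refine Finset.sum_congr rfl fun b _ => ?_
  rw [Matrix.diag, Matrix.mul_apply, Complex.re_sum]
  refine Finset.sum_congr rfl fun a _ => ?_
  rw [Matrix.mul_diagonal, Matrix.conjTranspose_apply, RCLike.star_def,
    mul_right_comm, Complex.mul_conj']
  norm_cast
  ring

/-- The diagonal projection onto a set of basis vectors. -/
def indP (A : Finset X) : Matrix X X ℂ := diagonal fun a => if a ∈ A then 1 else 0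

/-- A family of unitaries that twirls operators on the span of the basis vectors in `A`. -/
structure IsDesign {W : Type*} [Fintype W] (A : Finset X) (U : W → Matrix X X ℂ) : Prop where
  unitary : ∀ w, U w * (U w)ᴴ = 1
  comm : ∀ w, U w * indP A = indP A * U w
  twirl : ∀ b ∈ A, ∀ b' ∈ A, ∀ a a', ∑ w, U w a b * star (U w a' b')
    = if a = a' ∧ b = b' ∧ a ∈ A then (Fintype.card W : ℂ) / A.card else 0

lemma sum_norm_sq_trace_design {W : Type*} [Fintype W] {A : Finset X} {U : W → Matrix X X ℂ}
    (hU : IsDesign A U) (M : Matrix X X ℂ) :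
    ∑ w, ‖(M * (U w * indP A)).trace‖ ^ 2
      = (Fintype.card W : ℝ) / A.card * ∑ b ∈ A, ∑ a ∈ A, ‖M b a‖ ^ 2 := by
  have h1 : ∀ w, (M * (U w * indP A)).trace = ∑ b ∈ A, ∑ a, M b a * U w a b := by
    intro w
    rw [← Matrix.mul_assoc]
    simp only [Matrix.trace, Matrix.diag_apply, indP, Matrix.mul_diagonal, mul_ite, mul_one,
      mul_zero]
    rw [Finset.sum_ite_mem, Finset.univ_inter]
    simp only [Matrix.mul_apply]
  have h2 : ((∑ w, ‖(M * (U w * indP A)).trace‖ ^ 2 : ℝ) : ℂ)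
      = (((Fintype.card W : ℝ) / A.card * ∑ b ∈ A, ∑ a ∈ A, ‖M b a‖ ^ 2 : ℝ) : ℂ) := by
    push_cast
    simp only [h1, ← Complex.mul_conj', map_sum, map_mul, Finset.sum_mul_sum]
    rw [Finset.sum_comm, Finset.mul_sum]
    refine Finset.sum_congr rfl fun b hb => ?_
    rw [Finset.sum_comm]
    calc ∑ b' ∈ A, ∑ w, ∑ a, ∑ a', M b a * U w a b *
          ((starRingEnd ℂ) (M b' a') * (starRingEnd ℂ) (U w a' b'))
        = ∑ b' ∈ A, ∑ a, ∑ a', M b a * (starRingEnd ℂ) (M b' a') *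
            ∑ w, U w a b * star (U w a' b') := by
          refine Finset.sum_congr rfl fun b' _ => ?_
          rw [Finset.sum_comm]
          refine Finset.sum_congr rfl fun a _ => ?_
          rw [Finset.sum_comm]
          refine Finset.sum_congr rfl fun a' _ => ?_
          rw [Finset.mul_sum]
          refine Finset.sum_congr rfl fun w _ => ?_
          simp only [RCLike.star_def]
          ring
      _ = ∑ b' ∈ A, ∑ a, ∑ a', M b a * (starRingEnd ℂ) (M b' a') *
            (if a = a' ∧ b = b' ∧ a ∈ A then (Fintype.card W : ℂ) / A.card else 0) :=
          Finset.sum_congr rfl fun b' hb' => Finset.sum_congr rfl fun a _ =>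
            Finset.sum_congr rfl fun a' _ => by rw [hU.twirl b hb b' hb' a a']
      _ = ∑ a, ∑ a', ∑ b' ∈ A, M b a * (starRingEnd ℂ) (M b' a') *
            (if a = a' ∧ b = b' ∧ a ∈ A then (Fintype.card W : ℂ) / A.card else 0) := by
          rw [Finset.sum_comm]
          exact Finset.sum_congr rfl fun a _ => Finset.sum_comm
      _ = _ := by
          simp only [ite_and, mul_ite, mul_zero]
          simp [hb, Finset.mul_sum, mul_comm]
  exact_mod_cast h2

theorem design_code {ι S W Z : Type*} [Fintype ι] [Fintype S] [Fintype W] [Fintype Z]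
    [DecidableEq Y] [DecidableEq ι] [DecidableEq Z] [Nonempty W]
    (T : ι → S → Matrix Y X ℂ) (hT : ∀ i, ∑ s, (T i s)ᴴ * T i s = 1)
    {𝒯 : Finset X} (hne : 𝒯.Nonempty) {U : W → Matrix X X ℂ} (hU : IsDesign 𝒯 U)
    (lam : X → ℝ) (hlam : ∀ a, 0 ≤ lam a) (L : ℝ) (hL : ∀ a ∈ 𝒯, (𝒯.card : ℝ)⁻¹ ≤ L * lam a)
    (y : ι → Z → Matrix Y X ℂ) (hy : ∀ i z, nsq (y i z) = 1)
    (μ : ι → Z → ℝ) (hμ : ∀ i z, 0 ≤ μ i z)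
    (hens : ∀ i, ∑ s, vecMulVec (vc (T i s * diagonal fun a => (√(lam a) : ℂ)))
        (star (vc (T i s * diagonal fun a => (√(lam a) : ℂ))))
      = ∑ z, (μ i z : ℂ) • vecMulVec (vc (y i z)) (star (vc (y i z))))
    (A : ι → Finset Z) (c : ι → ℝ) (hc : ∀ i, 0 < c i) (ε₁ ε₂ : ℝ)
    (hε₁ : ∀ i, ∑ z ∈ (A i)ᶜ, μ i z ≤ ε₁)
    (hε₂ : ∀ i (Q : Matrix Y Y ℂ), Qᴴ * Q = 1 → ∀ G : Finset Y,
      (G.card : ℝ) * c i ≤ Fintype.card ι → ∑ e ∈ G,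
        ((Qᴴ * (∑ s, T i s * diagonal (fun a => (lam a : ℂ)) * (T i s)ᴴ) * Q) e e).re ≤ ε₂)
    (N : ℕ) :
    ∃ (w : Fin N → W) (F : Fin N → Matrix (Y × X) (Y × X) ℂ),
      (∀ α, (F α).PosSemidef) ∧ (1 - ∑ α, F α).PosSemidef ∧
      ∀ α i, 1 - 4 * (L * ε₁ + L * ε₂ + α * ((𝒯.card : ℝ)⁻¹ * ∑ i, c i * (A i).card)) ≤
          ∑ s, ((F α * vecMulVec
            (vc (((√(𝒯.card : ℝ))⁻¹ : ℂ) • (T i s * (U (w α) * indP 𝒯))))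
            (star (vc (((√(𝒯.card : ℝ))⁻¹ : ℂ) • (T i s * (U (w α) * indP 𝒯)))))).trace).re ∧
        ∑ s, ((F α * vecMulVec
            (vc (((√(𝒯.card : ℝ))⁻¹ : ℂ) • (T i s * (U (w α) * indP 𝒯))))
            (star (vc (((√(𝒯.card : ℝ))⁻¹ : ℂ) • (T i s * (U (w α) * indP 𝒯)))))).trace).re
          ≤ 1 := by
  set D : ℝ := (𝒯.card : ℝ) with hD
  have hD0 : 0 < D := by rw [hD]; exact_mod_cast hne.card_pos
  have hlam0 : ∀ a ∈ 𝒯, 0 < L * lam a := fun a ha => (inv_pos.2 hD0).trans_le (hL a ha)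
  have hL0 : 0 ≤ L := by
    obtain ⟨a, ha⟩ := hne
    exact (pos_of_mul_pos_left (hlam0 a ha) (hlam a)).le
  have hlam1 : ∀ a ∈ 𝒯, 0 < lam a := fun a ha => pos_of_mul_pos_right (hlam0 a ha) hL0
  have hsq : (((√D)⁻¹ : ℂ)) * ((√D)⁻¹ : ℂ) = ((D⁻¹ : ℝ) : ℂ) := by
    rw [← mul_inv, ← Complex.ofReal_mul, Real.mul_self_sqrt hD0.le, Complex.ofReal_inv]
  set d : X → ℝ := fun a => if a ∈ 𝒯 then D⁻¹ else 0 with hd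
  have hPP : indP 𝒯 * (indP 𝒯)ᴴ = indP 𝒯 := by
    simp [indP, Matrix.diagonal_conjTranspose, Matrix.diagonal_mul_diagonal]
  have hPd : ((D⁻¹ : ℝ) : ℂ) • indP 𝒯 = diagonal (fun a => (d a : ℂ)) := by
    rw [indP, ← Matrix.diagonal_smul]
    congr 1
    ext a
    simp only [hd, Pi.smul_apply, smul_eq_mul]
    split_ifs <;> simp
  have hdlam : ∀ a, d a ≤ L * lam a := by
    intro a
    simp only [hd]
    split_ifs with h
    · exact hL a h
    · exact mul_nonneg hL0 (hlam a)
  refine one_shot_code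
    (fun w i s => ((√D)⁻¹ : ℂ) • (T i s * (U w * indP 𝒯)))
    (fun i => ∑ s, T i s * diagonal (fun a => (d a : ℂ)) * (T i s)ᴴ)
    (fun w i z => y i z * (diagonal (fun a => if a ∈ 𝒯 then ((√(lam a))⁻¹ : ℂ) * (√D : ℂ)⁻¹ else 0)
      * U w)) μ A c D (L * ε₁) (L * ε₂) hμ hc hD0 ?_ ?_ ?_ ?_ ?_ ?_ N
  · intro i
    rw [Matrix.trace_sum]
    simp_rw [fun s => Matrix.trace_mul_comm (T i s * diagonal (fun a => (d a : ℂ))) (T i s)ᴴ,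
      ← Matrix.mul_assoc]
    rw [← Matrix.trace_sum, ← Matrix.sum_mul, hT, Matrix.one_mul, Matrix.trace_diagonal]
    simp only [hd]
    norm_cast
    rw [Finset.sum_ite_mem, Finset.univ_inter, Finset.sum_const, nsmul_eq_mul,
      mul_inv_cancel₀ hD0.ne']
  · intro w i
    refine Finset.sum_congr rfl fun s _ => ?_
    have hst : star ((√D)⁻¹ : ℂ) = ((√D)⁻¹ : ℂ) := by simp
    have hUP : U w * indP 𝒯 * (U w * indP 𝒯)ᴴ = indP 𝒯 := by
      rw [hU.comm, Matrix.conjTranspose_mul, Matrix.mul_assoc, ← Matrix.mul_assoc (U w),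
        hU.unitary, Matrix.one_mul, hPP]
    rw [Matrix.conjTranspose_smul, hst, Matrix.smul_mul, Matrix.mul_smul, smul_smul, hsq, ← hPd,
      Matrix.conjTranspose_mul, Matrix.mul_smul, Matrix.smul_mul, Matrix.mul_assoc,
      ← Matrix.mul_assoc (U w * indP 𝒯), hUP, Matrix.mul_assoc]
  · intro w i
    have h := ensemble_mul_right (hens i)
      (diagonal (fun a => if a ∈ 𝒯 then ((√(lam a))⁻¹ : ℂ) * (√D : ℂ)⁻¹ else 0) * U w)
    have hx : ∀ s, T i s * (diagonal fun a => (√(lam a) : ℂ)) *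
        (diagonal (fun a => if a ∈ 𝒯 then ((√(lam a))⁻¹ : ℂ) * (√D : ℂ)⁻¹ else 0) * U w)
        = ((√D)⁻¹ : ℂ) • (T i s * (U w * indP 𝒯)) := by
      intro s
      have : (diagonal fun a => (√(lam a) : ℂ)) *
          diagonal (fun a => if a ∈ 𝒯 then ((√(lam a))⁻¹ : ℂ) * (√D : ℂ)⁻¹ else 0)
          = ((√D)⁻¹ : ℂ) • indP 𝒯 := by
        rw [Matrix.diagonal_mul_diagonal, indP, ← Matrix.diagonal_smul]
        congr 1
        ext a
        by_cases ha : a ∈ 𝒯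
        · have : (√(lam a) : ℂ) ≠ 0 := by
            exact_mod_cast (Real.sqrt_pos.2 (hlam1 a ha)).ne'
          simp only [ha, if_true, Pi.smul_apply, smul_eq_mul, mul_one]
          rw [mul_inv_cancel_left₀ this]
        · simp [ha]
      rw [Matrix.mul_assoc, ← Matrix.mul_assoc (diagonal _) (diagonal _), this, hU.comm,
        Matrix.smul_mul, Matrix.mul_smul]
    simp_rw [hx] at h
    exact h
  · intro w i
    have hv : ∀ z, nsq (y i z * (diagonal (fun a => if a ∈ 𝒯 then
        ((√(lam a))⁻¹ : ℂ) * (√D : ℂ)⁻¹ else 0) * U w)) ≤ L := by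
      intro z
      rw [← Matrix.mul_assoc, nsq_mul_right (hU.unitary w), ← mul_one L, ← hy i z, nsq, nsq,
        Finset.mul_sum]
      simp_rw [Finset.mul_sum]
      refine Finset.sum_le_sum fun k _ => Finset.sum_le_sum fun a _ => ?_
      rw [Matrix.mul_diagonal, norm_mul, mul_pow, mul_comm]
      refine mul_le_mul_of_nonneg_right ?_ (by positivity)
      split_ifs with ha
      · rw [norm_mul, norm_inv, norm_inv, mul_pow, inv_pow, inv_pow, Complex.norm_real,
          Complex.norm_real, Real.norm_of_nonneg (Real.sqrt_nonneg _),
          Real.norm_of_nonneg (Real.sqrt_nonneg _), Real.sq_sqrt (hlam a), Real.sq_sqrt hD0.le,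
          inv_mul_le_iff₀ (hlam1 a ha), mul_comm]
        exact hL a ha
      · simpa using hL0
    calc _ ≤ ∑ z ∈ (A i)ᶜ, μ i z * L :=
          Finset.sum_le_sum fun z _ => mul_le_mul_of_nonneg_left (hv z) (hμ i z)
      _ = L * ∑ z ∈ (A i)ᶜ, μ i z := by rw [← Finset.sum_mul, mul_comm]
      _ ≤ L * ε₁ := mul_le_mul_of_nonneg_left (hε₁ i) hL0
  · intro i Q hQ G hG
    refine le_trans ?_ (mul_le_mul_of_nonneg_left (hε₂ i Q hQ G hG) hL0)
    rw [Finset.mul_sum _ _ L]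
    refine Finset.sum_le_sum fun e _ => ?_
    rw [re_conj_diagonal_apply, re_conj_diagonal_apply, Finset.mul_sum]
    refine Finset.sum_le_sum fun s _ => ?_
    rw [Finset.mul_sum]
    refine Finset.sum_le_sum fun a _ => ?_
    rw [← mul_assoc]
    exact mul_le_mul_of_nonneg_right (hdlam a) (by positivity)
  · intro i M
    rw [trace_conj_diagonal, Finset.sum_comm, Finset.mul_sum]
    refine Finset.sum_le_sum fun s _ => ?_
    have hx : ∀ w, ‖(Mᴴ * (((√D)⁻¹ : ℂ) • (T i s * (U w * indP 𝒯)))).trace‖ ^ 2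
        = D⁻¹ * ‖(Mᴴ * T i s * (U w * indP 𝒯)).trace‖ ^ 2 := by
      intro w
      rw [Matrix.mul_smul, Matrix.trace_smul, smul_eq_mul, norm_mul, mul_pow, norm_inv,
        Complex.norm_real, Real.norm_of_nonneg (Real.sqrt_nonneg _), inv_pow, Real.sq_sqrt hD0.le,
        Matrix.mul_assoc]
    refine (Finset.sum_congr rfl fun w _ => hx w).trans_le ?_
    rw [← Finset.mul_sum, sum_norm_sq_trace_design hU, mul_left_comm]
    refine mul_le_mul_of_nonneg_left ?_ (by positivity)
    rw [Finset.mul_sum]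
    refine (Finset.sum_le_sum_of_subset_of_nonneg (Finset.subset_univ 𝒯)
      fun b _ _ => by positivity).trans_eq ?_
    refine Finset.sum_congr rfl fun b _ => ?_
    simp only [hd, ite_mul, zero_mul]
    rw [Finset.sum_ite_mem, Finset.univ_inter, Finset.mul_sum]

end DesignCode

section Weyl

variable {X : Type*} [Fintype X] [DecidableEq X]

/-- Discrete Weyl operators on the span of a nonempty set of basis vectors form a design. -/
lemma exists_isDesign (A : Finset X) (hA : A.Nonempty) :
    ∃ (W : Type) (_ : Fintype W) (_ : Nonempty W) (U : W → Matrix X X ℂ), IsDesign A U := by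
  classical
  have : NeZero A.card := ⟨hA.card_pos.ne'⟩
  let e : A ≃ ZMod A.card := Fintype.equivOfCardEq (by simp [ZMod.card])
  let π : ZMod A.card → Equiv.Perm X := fun g =>
    Equiv.Perm.ofSubtype (p := fun x => x ∈ A) ((e.trans (Equiv.addRight g)).trans e.symm)
  let φ : AddChar (ZMod A.card) ℂ → X → ℂ := fun ψ b => if h : b ∈ A then ψ (e ⟨b, h⟩) else 1
  have hπ : ∀ g b (hb : b ∈ A), π g b = e.symm (e ⟨b, hb⟩ + g) := fun g b hb =>
    Equiv.Perm.ofSubtype_apply_of_mem (p := fun x => x ∈ A) _ hb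
  have hπ' : ∀ g b, π g b ∈ A ↔ b ∈ A := fun g b =>
    Equiv.Perm.ofSubtype_apply_mem_iff_mem (p := fun x => x ∈ A) _ b
  have hφ : ∀ ψ b, φ ψ b * star (φ ψ b) = 1 := by
    intro ψ b
    simp only [φ]
    split_ifs with h
    · rw [RCLike.star_def, ← AddChar.map_neg_eq_conj, ← AddChar.map_add_eq_mul]
      simp
    · simp
  let U : ZMod A.card × AddChar (ZMod A.card) ℂ → Matrix X X ℂ := fun w =>
    Matrix.of fun a b => if a = π w.1 b then φ w.2 b else 0
  refine ⟨_, inferInstance, ⟨(0, 1)⟩, U, ?_, ?_, ?_⟩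
  · intro w
    ext a a'
    simp only [Matrix.mul_apply, Matrix.conjTranspose_apply, U, Matrix.of_apply, Matrix.one_apply]
    rw [Finset.sum_eq_single ((π w.1).symm a)]
    · rw [if_pos (by simp)]
      by_cases h : a = a'
      · subst h
        rw [if_pos (by simp), if_pos rfl, hφ]
      · rw [if_neg (by simpa using Ne.symm h), if_neg h, star_zero, mul_zero]
    · intro b _ hb
      rw [if_neg, zero_mul]
      rintro rfl
      simp at hb
    · simp
  · intro w
    ext a b
    simp only [indP, Matrix.mul_diagonal, Matrix.diagonal_mul, U, Matrix.of_apply]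
    by_cases h : a = π w.1 b
    · subst h
      by_cases hb : b ∈ A <;> simp [hπ', hb]
    · simp [h]
  · intro b hb b' hb' a a'
    have hsum : ∑ w, U w a b * star (U w a' b') = ∑ g, (if a = π g b ∧ a' = π g b' then
        ∑ ψ : AddChar (ZMod A.card) ℂ, ψ (e ⟨b, hb⟩ - e ⟨b', hb'⟩) else 0) := by
      rw [Fintype.sum_prod_type]
      refine Finset.sum_congr rfl fun g _ => ?_
      simp only [U, Matrix.of_apply, φ, dif_pos hb, dif_pos hb']
      by_cases h1 : a = π g b
      · by_cases h2 : a' = π g b'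
        · rw [if_pos ⟨h1, h2⟩]
          refine Finset.sum_congr rfl fun ψ _ => ?_
          rw [if_pos h1, if_pos h2, RCLike.star_def, ← AddChar.map_neg_eq_conj,
            ← AddChar.map_add_eq_mul, sub_eq_add_neg]
        · simp [h2]
      · simp [h1]
    have hcard : (Fintype.card (ZMod A.card × AddChar (ZMod A.card) ℂ) : ℂ) / A.card = A.card := by
      rw [Fintype.card_prod, AddChar.card_eq, ZMod.card]
      have : (A.card : ℂ) ≠ 0 := by exact_mod_cast hA.card_pos.ne'
      push_cast
      field_simp
    rw [hsum, AddChar.sum_apply_eq_ite, hcard, ZMod.card]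
    by_cases hbb : b = b'
    · subst hbb
      simp only [sub_self, if_true, true_and]
      by_cases haa : a = a'
      · subst haa
        simp only [and_self, true_and]
        by_cases ha : a ∈ A
        · rw [if_pos ha, Finset.sum_eq_single (e ⟨a, ha⟩ - e ⟨b, hb⟩)]
          · rw [if_pos]
            rw [hπ _ _ hb]; simp
          · intro g _ hg
            rw [if_neg]
            intro h
            apply hg
            rw [hπ _ _ hb] at h
            have : (⟨a, ha⟩ : A) = e.symm (e ⟨b, hb⟩ + g) := Subtype.ext h
            rw [this]; simp
          · simp
        · rw [if_neg ha]
          refine Finset.sum_eq_zero fun g _ => if_neg ?_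
          rintro rfl
          exact ha ((hπ' g b).2 hb)
      · rw [if_neg (by tauto)]
        refine Finset.sum_eq_zero fun g _ => if_neg ?_
        rintro ⟨rfl, rfl⟩
        exact haa rfl
    · have h1 : e ⟨b, hb⟩ - e ⟨b', hb'⟩ ≠ 0 := by simpa [sub_eq_zero] using hbb
      simp [h1, hbb]

end Weyl

section TensorPower

variable {ι I J K : Type*} [Fintype ι]

/-- Tensor product of a finite family of matrices. -/
def tp (A : ι → Matrix I J ℂ) : Matrix (ι → I) (ι → J) ℂ := fun f g => ∏ k, A k (f k) (g k)

lemma tp_mul [DecidableEq ι] [Fintype J] (A : ι → Matrix I J ℂ) (B : ι → Matrix J K ℂ) :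
    tp A * tp B = tp fun k => A k * B k := by
  ext f g
  simp only [Matrix.mul_apply, tp, ← Finset.prod_mul_distrib]
  exact sum_pi_prod fun k j => A k (f k) j * B k j (g k)

lemma tp_conjTranspose (A : ι → Matrix I J ℂ) : (tp A)ᴴ = tp fun k => (A k)ᴴ := by
  ext f g
  simp [tp, Matrix.conjTranspose_apply]

lemma tp_diagonal [DecidableEq I] (d : ι → I → ℂ) :
    tp (fun k => diagonal (d k)) = diagonal fun f => ∏ k, d k (f k) := by
  ext f g
  by_cases h : f = g
  · subst h; simp [tp]
  · rw [Matrix.diagonal_apply_ne _ h]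
    obtain ⟨k, hk⟩ := Function.ne_iff.1 h
    exact Finset.prod_eq_zero (Finset.mem_univ k) (Matrix.diagonal_apply_ne _ hk)

lemma tp_one [DecidableEq ι] [DecidableEq I] : tp (fun _ : ι => (1 : Matrix I I ℂ)) = 1 := by
  simp_rw [← Matrix.diagonal_one, tp_diagonal]
  simp

lemma sum_tp [DecidableEq ι] {S : Type*} [Fintype S] (A : ι → S → Matrix I J ℂ) :
    ∑ s : ι → S, tp (fun k => A k (s k)) = tp fun k => ∑ s, A k s := by
  ext f g
  simp only [Matrix.sum_apply, tp]
  exact sum_pi_prod fun k s => A k s (f k) (g k)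

lemma tp_smul (c : ι → ℂ) (A : ι → Matrix I J ℂ) :
    tp (fun k => c k • A k) = (∏ k, c k) • tp A := by
  ext f g
  simp [tp, Finset.prod_mul_distrib]

lemma nsq_tp [DecidableEq ι] [Fintype I] [Fintype J] (A : ι → Matrix I J ℂ) : nsq (tp A) = ∏ k, nsq (A k) := by
  simp only [nsq, tp, norm_prod, ← Finset.prod_pow]
  rw [← sum_pi_prod (fun k i => ∑ j, ‖A k i j‖ ^ 2)]
  exact Finset.sum_congr rfl fun f _ => sum_pi_prod fun k j => ‖A k (f k) j‖ ^ 2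

lemma ensemble_tp [DecidableEq ι] {S Z : Type*} [Fintype S] [Fintype Z] {x : S → Matrix I J ℂ}
    {v : Z → Matrix I J ℂ} {μ : Z → ℝ}
    (h : ∑ s, vecMulVec (vc (x s)) (star (vc (x s)))
      = ∑ z, (μ z : ℂ) • vecMulVec (vc (v z)) (star (vc (v z)))) :
    ∑ s : ι → S, vecMulVec (vc (tp fun k => x (s k))) (star (vc (tp fun k => x (s k))))
      = ∑ z : ι → Z, ((∏ k, μ (z k) : ℝ) : ℂ) •
        vecMulVec (vc (tp fun k => v (z k))) (star (vc (tp fun k => v (z k)))) := by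
  ext p q
  have h1 := fun k : ι => congrFun (congrFun h (p.1 k, p.2 k)) (q.1 k, q.2 k)
  simp only [Matrix.sum_apply, Matrix.smul_apply, vecMulVec_apply, Pi.star_apply, vc,
    smul_eq_mul] at h1
  simp only [Matrix.sum_apply, Matrix.smul_apply, vecMulVec_apply, Pi.star_apply, vc,
    smul_eq_mul, tp, star_prod, Complex.ofReal_prod, ← Finset.prod_mul_distrib]
  rw [sum_pi_prod (fun k s => x s (p.1 k) (p.2 k) * star (x s (q.1 k) (q.2 k))),
    sum_pi_prod (fun k z => (μ z : ℂ) * (v z (p.1 k) (p.2 k) * star (v z (q.1 k) (q.2 k))))]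
  exact Finset.prod_congr rfl fun k _ => h1 k

lemma tp_indP [DecidableEq ι] [DecidableEq I] (A : Finset I) :
    tp (fun _ : ι => indP A) = indP (Fintype.piFinset fun _ : ι => A) := by
  simp only [indP, tp_diagonal]
  congr 1
  ext f
  simp only [Fintype.mem_piFinset, Finset.prod_ite_zero, Finset.mem_univ, true_imp_iff,
    Finset.prod_const_one]

lemma IsDesign.tp [DecidableEq ι] [Fintype I] [DecidableEq I] {W : Type*} [Fintype W] {A : Finset I}
    {U : W → Matrix I I ℂ} (hU : IsDesign A U) :
    IsDesign (Fintype.piFinset fun _ : ι => A) fun w : ι → W => tp fun k => U (w k) where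
  unitary w := by
    rw [tp_conjTranspose, tp_mul]
    simp only [hU.unitary, tp_one]
  comm w := by
    rw [← tp_indP, tp_mul, tp_mul]
    simp only [hU.comm]
  twirl b hb b' hb' a a' := by
    simp only [Fintype.mem_piFinset] at hb hb'
    simp only [_root_.tp, star_prod, ← Finset.prod_mul_distrib]
    rw [sum_pi_prod (fun k w => U w (a k) (b k) * star (U w (a' k) (b' k))),
      Finset.prod_congr rfl fun k _ => hU.twirl _ (hb k) _ (hb' k) _ _, Finset.prod_ite_zero]
    simp [Fintype.card_piFinset, funext_iff, forall_and]

end TensorPower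

section Typical

variable {Z : Type*} [Fintype Z]

/-- `entropy_tails` for doubly indexed families. -/
lemma entropy_tails₂ (q : Z → ℝ) (hq : ∀ z, 0 ≤ q z) (hq1 : ∑ z, q z = 1) {δ : ℝ} (hδ : 0 < δ) :
    ∃ c > 0, ∀ (n m : ℕ) (s : Finset (Fin n → Fin m → Z)),
      ((∀ z ∈ s, ∏ k, ∏ l, q (z k l) ≤
          Real.exp (-(n * m * (∑ z, Real.negMulLog (q z) + δ)))) →
        ∑ z ∈ s, ∏ k, ∏ l, q (z k l) ≤ Real.exp (-(c * (n * m)))) ∧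
      ((∀ z ∈ s, Real.exp (-(n * m * (∑ z, Real.negMulLog (q z) - δ))) ≤
          ∏ k, ∏ l, q (z k l)) →
        ∑ z ∈ s, ∏ k, ∏ l, q (z k l) ≤ Real.exp (-(c * (n * m)))) := by
  obtain ⟨c, hc, H⟩ := entropy_tails q hq hq1 hδ
  refine ⟨c, hc, fun n m s => ?_⟩
  have h := H (ι := Fin n × Fin m) (s.map (Equiv.curry (Fin n) (Fin m) Z).symm.toEmbedding)
  simp only [Finset.mem_map_equiv, Equiv.symm_symm, Finset.sum_map, Equiv.coe_toEmbedding,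
    Fintype.prod_prod_type, Fintype.card_prod, Fintype.card_fin, Nat.cast_mul] at h
  exact ⟨fun hs => h.1 fun z hz => hs _ hz, fun hs => h.2 fun z hz => hs _ hz⟩

lemma exists_typical_set (q : Z → ℝ) (hq : ∀ z, 0 ≤ q z) (hq1 : ∑ z, q z = 1) {δ : ℝ}
    (hδ : 0 < δ) : ∀ᶠ m : ℕ in Filter.atTop, ∃ A : Finset (Fin m → Z),
      (∀ a ∈ A, Real.exp (-(m * (∑ z, Real.negMulLog (q z) + δ))) ≤ ∏ l, q (a l)) ∧
      2⁻¹ * Real.exp (m * (∑ z, Real.negMulLog (q z) - δ)) ≤ A.card := by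
  classical
  set h := ∑ z, Real.negMulLog (q z) with hh
  obtain ⟨c, hc, H⟩ := entropy_tails q hq hq1 hδ
  have hlim : Filter.Tendsto (fun m : ℕ => Real.exp (-(c * m))) Filter.atTop (nhds 0) :=
    Real.tendsto_exp_neg_atTop_nhds_zero.comp
      (tendsto_natCast_atTop_atTop.const_mul_atTop hc)
  filter_upwards [hlim.eventually_lt_const (show (0 : ℝ) < 4⁻¹ by norm_num)] with m hm
  have hp : ∀ a : Fin m → Z, 0 ≤ ∏ l, q (a l) := fun a => Finset.prod_nonneg fun l _ => hq _
  set lo := Real.exp (-(m * (h + δ))) with hlo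
  set hi := Real.exp (-(m * (h - δ))) with hhi
  let A : Finset (Fin m → Z) :=
    Finset.univ.filter fun a => lo ≤ ∏ l, q (a l) ∧ ∏ l, q (a l) ≤ hi
  refine ⟨A, fun a ha => (Finset.mem_filter.1 ha).2.1, ?_⟩
  have h1 := (H (ι := Fin m) (Finset.univ.filter fun a => ∏ l, q (a l) ≤ lo)).1
    (by simp [hlo, hh])
  have h2 := (H (ι := Fin m) (Finset.univ.filter fun a => hi ≤ ∏ l, q (a l))).2
    (by simp [hhi, hh])
  simp only [Fintype.card_fin] at h1 h2
  have htot : ∑ a : Fin m → Z, ∏ l, q (a l) = 1 := by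
    rw [sum_pi_prod (fun _ z => q z)]
    simp [hq1]
  have hcov : ∑ a : Fin m → Z, ∏ l, q (a l) ≤ ∑ a ∈ A, ∏ l, q (a l) +
      (∑ a : Fin m → Z with ∏ l, q (a l) ≤ lo, ∏ l, q (a l) +
        ∑ a : Fin m → Z with hi ≤ ∏ l, q (a l), ∏ l, q (a l)) := by
    simp only [A, Finset.sum_filter, ← Finset.sum_add_distrib]
    refine Finset.sum_le_sum fun a _ => ?_
    have := hp a
    rcases le_total lo (∏ l, q (a l)) with h3 | h3 <;>
      rcases le_total (∏ l, q (a l)) hi with h4 | h4 <;>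
      simp only [h3, h4, and_self, if_true, true_and, and_true] <;>
      split_ifs <;> linarith
  have hA : 2⁻¹ ≤ ∑ a ∈ A, ∏ l, q (a l) := by linarith
  have hA2 : ∑ a ∈ A, ∏ l, q (a l) ≤ A.card * hi := by
    rw [← nsmul_eq_mul]
    exact Finset.sum_le_card_nsmul _ _ _ fun a ha => (Finset.mem_filter.1 ha).2.2
  have h5 : Real.exp (m * (h - δ)) * hi = 1 := by
    rw [hhi, ← Real.exp_add]; simp
  calc 2⁻¹ * Real.exp (m * (h - δ)) ≤ (A.card * hi) * Real.exp (m * (h - δ)) :=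
        mul_le_mul_of_nonneg_right (hA.trans hA2) (Real.exp_pos _).le
    _ = A.card := by rw [mul_assoc, mul_comm hi, h5, mul_one]

lemma sum_diag_le {X : Type*} [Fintype X] [DecidableEq X] (V : Matrix X X ℂ) (hV : Vᴴ * V = 1)
    (d : X → ℝ) (hd : ∀ a, 0 ≤ d a) {t : ℝ} (ht : 0 ≤ t) (Q : Matrix X X ℂ) (hQ : Qᴴ * Q = 1)
    (G : Finset X) :
    ∑ e ∈ G, ((Qᴴ * (V * diagonal (fun a => (d a : ℂ)) * Vᴴ) * Q) e e).re
      ≤ ∑ a with t ≤ d a, d a + t * G.card := by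
  have hQ' : Q * Qᴴ = 1 := mul_eq_one_comm.1 hQ
  have hV' : V * Vᴴ = 1 := mul_eq_one_comm.1 hV
  set C := Qᴴ * V with hC
  have hC1 : Cᴴ * C = 1 := by
    rw [hC, Matrix.conjTranspose_mul, Matrix.conjTranspose_conjTranspose, Matrix.mul_assoc,
      ← Matrix.mul_assoc Q, hQ', Matrix.one_mul, hV]
  have hC2 : C * Cᴴ = 1 := mul_eq_one_comm.1 hC1
  have hcol : ∀ a, ∑ e, ‖C e a‖ ^ 2 = 1 := by
    intro a
    have h1 := congrFun (congrFun hC1 a) a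
    simp only [Matrix.mul_apply, Matrix.conjTranspose_apply, Matrix.one_apply_eq,
      RCLike.star_def, Complex.conj_mul'] at h1
    exact_mod_cast h1
  have hrow : ∀ e, ∑ a, ‖C e a‖ ^ 2 = 1 := by
    intro e
    have h1 := congrFun (congrFun hC2 e) e
    simp only [Matrix.mul_apply, Matrix.conjTranspose_apply, Matrix.one_apply_eq,
      RCLike.star_def, Complex.mul_conj'] at h1
    exact_mod_cast h1
  have h1 : ∀ e, ((Qᴴ * (V * diagonal (fun a => (d a : ℂ)) * Vᴴ) * Q) e e).re
      = ∑ a, d a * ‖C e a‖ ^ 2 := by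
    intro e
    have := re_conj_diagonal_apply (S := Unit) (fun _ => V) d Q e
    simpa using this
  simp_rw [h1]
  have h2 : ∀ e a, d a * ‖C e a‖ ^ 2
      ≤ (if t ≤ d a then d a else 0) * ‖C e a‖ ^ 2 + t * ‖C e a‖ ^ 2 := by
    intro e a
    split_ifs with h
    · exact le_add_of_nonneg_right (by positivity)
    · rw [zero_mul, zero_add]
      exact mul_le_mul_of_nonneg_right (not_le.1 h).le (by positivity)
  calc ∑ e ∈ G, ∑ a, d a * ‖C e a‖ ^ 2
      ≤ ∑ e ∈ G, ∑ a, ((if t ≤ d a then d a else 0) * ‖C e a‖ ^ 2 + t * ‖C e a‖ ^ 2) :=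
        Finset.sum_le_sum fun e _ => Finset.sum_le_sum fun a _ => h2 e a
    _ = ∑ a, (if t ≤ d a then d a else 0) * ∑ e ∈ G, ‖C e a‖ ^ 2 + t * G.card := by
        simp only [Finset.sum_add_distrib, ← Finset.mul_sum, hrow]
        rw [Finset.sum_comm]
        simp [Finset.mul_sum]
    _ ≤ ∑ a, (if t ≤ d a then d a else 0) * 1 + t * G.card := by
        gcongr with a
        · split_ifs
          · exact hd a
          · exact le_rfl
        · rw [← hcol a]
          exact Finset.sum_le_sum_of_subset_of_nonneg (Finset.subset_univ _)
            fun _ _ _ => by positivity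
    _ = _ := by simp [Finset.sum_filter]

end Typical

section BlockCode

variable {K H S Z : Type*} [Fintype K] [DecidableEq K] [Fintype H] [DecidableEq H] [Fintype S]
  [Fintype Z] [DecidableEq Z]

lemma sum_tp₂ {I J : Type*} (A : S → Matrix I J ℂ) (n m : ℕ) :
    ∑ s : Fin n → Fin m → S, tp (fun k => tp fun l => A (s k l))
      = tp fun _ => tp fun _ => ∑ s, A s := by
  rw [sum_tp (fun (_ : Fin n) (r : Fin m → S) => tp fun l => A (r l))]
  congr 1
  funext _
  exact sum_tp fun _ => A

lemma sum_pi₂_prod {Z : Type*} [Fintype Z] (q : Z → ℝ) (hq1 : ∑ z, q z = 1) (n m : ℕ) :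
    ∑ z : Fin n → Fin m → Z, ∏ k, ∏ l, q (z k l) = 1 := by
  rw [sum_pi_prod (fun (_ : Fin n) (r : Fin m → Z) => ∏ l, q (r l)),
    sum_pi_prod (fun (_ : Fin m) r => q r)]
  simp [hq1]

lemma diagonal_prod₂ {E : Type*} [DecidableEq E] (d : E → ℝ) (n m : ℕ) :
    (diagonal fun a : Fin n → Fin m → E => ((∏ k, ∏ l, d (a k l) : ℝ) : ℂ))
      = tp fun _ => tp fun _ => diagonal fun a => (d a : ℂ) := by
  simp only [tp_diagonal]
  push_cast
  rfl

theorem block_code {ι W : Type*} [Fintype ι] [DecidableEq ι] [Fintype W] [Nonempty W]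
    (T : ι → S → Matrix K H ℂ) (hT : ∀ i, ∑ s, (T i s)ᴴ * T i s = 1)
    (lam : H → ℝ) (hlam : ∀ a, 0 ≤ lam a)
    (y : ι → Z → Matrix K H ℂ) (hy : ∀ i z, nsq (y i z) = 1)
    (μ : ι → Z → ℝ) (hμ : ∀ i z, 0 ≤ μ i z) (hμ1 : ∀ i, ∑ z, μ i z = 1)
    (hens : ∀ i, ∑ s, vecMulVec (vc (T i s * diagonal fun a => (√(lam a) : ℂ)))
        (star (vc (T i s * diagonal fun a => (√(lam a) : ℂ))))
      = ∑ z, (μ i z : ℂ) • vecMulVec (vc (y i z)) (star (vc (y i z))))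
    (R : ι → Matrix K K ℂ) (hR : ∀ i, (R i)ᴴ * R i = 1)
    (ν : ι → K → ℝ) (hν : ∀ i e, 0 ≤ ν i e)
    (hout : ∀ i, ∑ s, T i s * diagonal (fun a => (lam a : ℂ)) * (T i s)ᴴ
      = R i * diagonal (fun e => (ν i e : ℂ)) * (R i)ᴴ)
    {n m : ℕ} {A : Finset (Fin m → H)} (hA : A.Nonempty) {U : W → Matrix (Fin m → H) (Fin m → H) ℂ}
    (hU : IsDesign A U) (L : ℝ) (hL : ∀ a ∈ A, (A.card : ℝ)⁻¹ ≤ L * ∏ l, lam (a l))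
    (p q : ι → ℝ) (δ c : ℝ)
    (htp : ∀ i (s : Finset (Fin n → Fin m → Z)),
      (∀ z ∈ s, ∏ k, ∏ l, μ i (z k l) ≤ Real.exp (-(n * m * (p i + δ)))) →
        ∑ z ∈ s, ∏ k, ∏ l, μ i (z k l) ≤ Real.exp (-(c * (n * m))))
    (htq : ∀ i (s : Finset (Fin n → Fin m → K)),
      (∀ z ∈ s, Real.exp (-(n * m * (q i - δ))) ≤ ∏ k, ∏ l, ν i (z k l)) →
        ∑ z ∈ s, ∏ k, ∏ l, ν i (z k l) ≤ Real.exp (-(c * (n * m))))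
    (N : ℕ) :
    ∃ (w : Fin N → Fin n → W)
      (F : Fin N → Matrix ((Fin n → Fin m → K) × (Fin n → Fin m → H))
        ((Fin n → Fin m → K) × (Fin n → Fin m → H)) ℂ),
      (∀ α, (F α).PosSemidef) ∧ (1 - ∑ α, F α).PosSemidef ∧
      ∀ α i, 1 - 4 * (L ^ n * Real.exp (-(c * (n * m))) + L ^ n * (Real.exp (-(c * (n * m)))
          + Fintype.card ι * Real.exp (-(n * m * δ)))
          + α * ((A.card ^ n : ℝ)⁻¹ * ∑ i, Real.exp (n * m * (p i - q i + 3 * δ)))) ≤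
          ∑ s : Fin n → Fin m → S, ((F α * vecMulVec
            (vc (tp fun k => ((√(A.card : ℝ))⁻¹ : ℂ) •
              ((tp fun l => T i (s k l)) * (U (w α k) * indP A))))
            (star (vc (tp fun k => ((√(A.card : ℝ))⁻¹ : ℂ) •
              ((tp fun l => T i (s k l)) * (U (w α k) * indP A)))))).trace).re ∧
        ∑ s : Fin n → Fin m → S, ((F α * vecMulVec
            (vc (tp fun k => ((√(A.card : ℝ))⁻¹ : ℂ) •
              ((tp fun l => T i (s k l)) * (U (w α k) * indP A))))
            (star (vc (tp fun k => ((√(A.card : ℝ))⁻¹ : ℂ) •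
              ((tp fun l => T i (s k l)) * (U (w α k) * indP A)))))).trace).re ≤ 1 := by
  have hμp : ∀ i (z : Fin n → Fin m → Z), 0 ≤ ∏ k, ∏ l, μ i (z k l) := fun i z =>
    Finset.prod_nonneg fun _ _ => Finset.prod_nonneg fun _ _ => hμ _ _
  have hνp : ∀ i (z : Fin n → Fin m → K), 0 ≤ ∏ k, ∏ l, ν i (z k l) := fun i z =>
    Finset.prod_nonneg fun _ _ => Finset.prod_nonneg fun _ _ => hν _ _
  have hlp : ∀ z : Fin n → Fin m → H, 0 ≤ ∏ k, ∏ l, lam (z k l) := fun z =>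
    Finset.prod_nonneg fun _ _ => Finset.prod_nonneg fun _ _ => hlam _
  let Ai : ι → Finset (Fin n → Fin m → Z) := fun i =>
    Finset.univ.filter fun z => Real.exp (-(n * m * (p i + δ))) ≤ ∏ k, ∏ l, μ i (z k l)
  have hAi : ∀ i, ((Ai i).card : ℝ) ≤ Real.exp (n * m * (p i + δ)) := by
    intro i
    have h1 : (Ai i).card * Real.exp (-(n * m * (p i + δ))) ≤ 1 := by
      rw [← sum_pi₂_prod (μ i) (hμ1 i) n m, ← nsmul_eq_mul]
      exact (Finset.card_nsmul_le_sum _ _ _ fun z hz => (Finset.mem_filter.1 hz).2).trans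
        (Finset.sum_le_sum_of_subset_of_nonneg (Finset.subset_univ _) fun z _ _ => hμp i z)
    rwa [Real.exp_neg, ← div_eq_mul_inv, div_le_one (Real.exp_pos _)] at h1
  obtain ⟨w, F, h1, h2, h3⟩ : ∃ (w : Fin N → Fin n → W) (F : Fin N → Matrix _ _ ℂ), _ :=
    design_code (Y := Fin n → Fin m → K) (X := Fin n → Fin m → H)
    (S := Fin n → Fin m → S) (Z := Fin n → Fin m → Z)
    (fun i s => tp fun k => tp fun l => T i (s k l)) (by
      intro i
      simp only [tp_conjTranspose, tp_mul]
      rw [sum_tp₂ (fun s => (T i s)ᴴ * T i s), hT]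
      simp only [tp_one])
    (𝒯 := Fintype.piFinset fun _ : Fin n => A) (Fintype.piFinset_nonempty.2 fun _ => hA)
    hU.tp (fun a => ∏ k, ∏ l, lam (a k l)) hlp (L ^ n) (by
      intro a ha
      rw [Fintype.mem_piFinset] at ha
      rw [Fintype.card_piFinset, Finset.prod_const, Finset.card_univ, Fintype.card_fin,
        Nat.cast_pow, ← inv_pow]
      calc ((A.card : ℝ)⁻¹) ^ n = ∏ k : Fin n, (A.card : ℝ)⁻¹ := by simp
        _ ≤ ∏ k : Fin n, (L * ∏ l, lam (a k l)) :=
          Finset.prod_le_prod (fun _ _ => by positivity) fun k _ => hL _ (ha k)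
        _ = _ := by rw [Finset.prod_mul_distrib]; simp)
    (fun i z => tp fun k => tp fun l => y i (z k l)) (by
      intro i z
      simp [nsq_tp, hy])
    (fun i z => ∏ k, ∏ l, μ i (z k l)) hμp (by
      intro i
      have h1 := ensemble_tp (ι := Fin n) (ensemble_tp (ι := Fin m) (hens i))
      have h2 : (diagonal fun a : Fin n → Fin m → H => (√(∏ k, ∏ l, lam (a k l)) : ℂ))
          = tp fun _ => tp fun _ => diagonal fun a => (√(lam a) : ℂ) := by
        rw [← diagonal_prod₂]
        congr 1
        ext a
        congr 1
        rw [Real.sqrt_eq_iff_mul_self_eq (hlp a) (by positivity)]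
        simp only [← Finset.prod_mul_distrib, Real.mul_self_sqrt (hlam _)]
      simp only [h2, tp_mul]
      exact h1)
    Ai (fun i => Real.exp (-(n * m * (q i - 2 * δ)))) (fun i => Real.exp_pos _)
    (Real.exp (-(c * (n * m))))
    (Real.exp (-(c * (n * m))) + Fintype.card ι * Real.exp (-(n * m * δ)))
    (by
      intro i
      refine htp i _ fun z hz => ?_
      simp only [Ai, Finset.mem_compl, Finset.mem_filter, Finset.mem_univ, true_and, not_le] at hz
      exact hz.le)
    (by
      intro i Q hQ G hG
      have h1 : ∑ s : Fin n → Fin m → S, (tp (fun k => tp fun l => T i (s k l)) :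
              Matrix (Fin n → Fin m → K) (Fin n → Fin m → H) ℂ) *
          (diagonal fun a : Fin n → Fin m → H => ((∏ k, ∏ l, lam (a k l) : ℝ) : ℂ)) *
          (tp (fun k => tp fun l => T i (s k l)) :
              Matrix (Fin n → Fin m → K) (Fin n → Fin m → H) ℂ)ᴴ
          = (tp (fun _ => tp fun _ => R i) :
              Matrix (Fin n → Fin m → K) (Fin n → Fin m → K) ℂ) *
            (diagonal fun a : Fin n → Fin m → K => ((∏ k, ∏ l, ν i (a k l) : ℝ) : ℂ)) *
            (tp (fun _ => tp fun _ => R i) :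
              Matrix (Fin n → Fin m → K) (Fin n → Fin m → K) ℂ)ᴴ := by
        simp only [diagonal_prod₂, tp_conjTranspose, tp_mul]
        rw [sum_tp₂ (fun s => T i s * diagonal (fun a => (lam a : ℂ)) * (T i s)ᴴ), hout]
      rw [h1]
      refine (sum_diag_le _ ?_ _ (hνp i) (Real.exp_pos (-(n * m * (q i - δ)))).le Q hQ G).trans ?_
      · simp only [tp_conjTranspose, tp_mul, hR, tp_one]
      refine add_le_add (htq i _ fun z hz => (Finset.mem_filter.1 hz).2) ?_
      calc Real.exp (-(n * m * (q i - δ))) * G.card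
          = (G.card * Real.exp (-(n * m * (q i - 2 * δ)))) * Real.exp (-(n * m * δ)) := by
            rw [mul_assoc (G.card : ℝ), ← Real.exp_add, mul_comm]
            congr 2
            ring
        _ ≤ _ := mul_le_mul_of_nonneg_right hG (Real.exp_pos _).le)
    N
  refine ⟨w, F, h1, h2, fun α i => ?_⟩
  have hx : ∀ s : Fin n → Fin m → S,
      ((√((Fintype.piFinset fun _ : Fin n => A).card : ℝ))⁻¹ : ℂ) •
        ((tp fun k => tp fun l => T i (s k l)) *
          ((tp fun k => U (w α k)) * indP (Fintype.piFinset fun _ : Fin n => A)))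
      = tp fun k => ((√(A.card : ℝ))⁻¹ : ℂ) •
          ((tp fun l => T i (s k l)) * (U (w α k) * indP A)) := by
    intro s
    rw [tp_smul, ← tp_indP, tp_mul, tp_mul]
    have h5 : √((A.card : ℝ) ^ n) = √(A.card : ℝ) ^ n := by
      rw [Real.sqrt_eq_iff_mul_self_eq (by positivity) (by positivity), ← mul_pow,
        Real.mul_self_sqrt (by positivity)]
    congr 1
    simp [Fintype.card_piFinset, h5]
  have h4 := h3 α i
  simp only [hx] at h4
  refine ⟨le_trans ?_ h4.1, h4.2⟩
  gcongr 1 - 4 * (_ + α * ?_)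
  rw [Fintype.card_piFinset, Finset.prod_const, Finset.card_univ, Fintype.card_fin, Nat.cast_pow]
  gcongr with i
  calc Real.exp (-(n * m * (q i - 2 * δ))) * (Ai i).card
      ≤ Real.exp (-(n * m * (q i - 2 * δ))) * Real.exp (n * m * (p i + δ)) := by
        gcongr; exact hAi i
    _ = _ := by rw [← Real.exp_add]; congr 1; ring

end BlockCode

section IIDCode

lemma exists_pos_forall_le_of_finite {ι : Type*} [Finite ι] (c : ι → ℝ) (hc : ∀ i, 0 < c i) :
    ∃ b > 0, ∀ i, b ≤ c i := by
  cases nonempty_fintype ι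
  cases isEmpty_or_nonempty ι
  · exact ⟨1, one_pos, fun i => isEmptyElim i⟩
  · exact ⟨Finset.univ.inf' Finset.univ_nonempty c, (Finset.lt_inf'_iff _).2 fun i _ => hc i,
      fun i => Finset.inf'_le _ (Finset.mem_univ i)⟩

lemma error_le {ι : Type*} [Fintype ι] {n m : ℕ} {L C c δ ε h0 J α : ℝ} {p q : ι → ℝ}
    (hJ : ∀ i, J ≤ h0 + q i - p i) (hδ : 0 ≤ δ) (hε : ε ≤ δ) (hε' : 4 * ε ≤ c) (hcδ : c ≤ δ)
    (hm : Real.exp (-(m * (c / 2))) ≤ 4⁻¹)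
    (hL : L = 2 * Real.exp (2 * m * ε)) (hC : 0 < C) (hC' : C⁻¹ ≤ 2 * Real.exp (-(m * (h0 - ε))))
    (hα : α ≤ Real.exp (n * m * (J - 5 * δ))) :
    4 * (L ^ n * Real.exp (-(c * (n * m))) + L ^ n * (Real.exp (-(c * (n * m)))
      + Fintype.card ι * Real.exp (-(n * m * δ)))
      + α * ((C ^ n)⁻¹ * ∑ i, Real.exp (n * m * (p i - q i + 3 * δ))))
      ≤ (8 + 8 * Fintype.card ι) * 2⁻¹ ^ n := by
  have hm0 : (0 : ℝ) ≤ m := by positivity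
  have key : ∀ x : ℝ, x ≤ -(m * (c / 2)) → (2 * Real.exp x) ^ n ≤ 2⁻¹ ^ n := fun x hx =>
    pow_le_pow_left₀ (by positivity) (by
      have := (Real.exp_le_exp.2 hx).trans hm
      linarith) n
  have hLn : ∀ x : ℝ, L ^ n * Real.exp (n * x) = (2 * Real.exp (2 * m * ε + x)) ^ n := by
    intro x
    rw [hL, Real.exp_nat_mul, ← mul_pow, mul_assoc, ← Real.exp_add]
  have h1 : L ^ n * Real.exp (-(c * (n * m))) ≤ 2⁻¹ ^ n := by
    rw [show -(c * (n * m)) = n * (-(c * m)) by ring, hLn]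
    exact key _ (by nlinarith)
  have h2 : L ^ n * Real.exp (-(n * m * δ)) ≤ 2⁻¹ ^ n := by
    rw [show -(n * m * δ) = n * (-(m * δ)) by ring, hLn]
    exact key _ (by nlinarith)
  have h3 : ∀ i, α * ((C ^ n)⁻¹ * Real.exp (n * m * (p i - q i + 3 * δ))) ≤ 2⁻¹ ^ n := by
    intro i
    calc α * ((C ^ n)⁻¹ * Real.exp (n * m * (p i - q i + 3 * δ)))
        ≤ Real.exp (n * m * (J - 5 * δ)) * ((2 * Real.exp (-(m * (h0 - ε)))) ^ n *
            Real.exp (n * m * (p i - q i + 3 * δ))) := by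
          rw [← inv_pow]
          gcongr
      _ = (2 * Real.exp (m * (J - 5 * δ) + (-(m * (h0 - ε))) + m * (p i - q i + 3 * δ))) ^ n := by
          rw [show n * m * (J - 5 * δ) = n * (m * (J - 5 * δ)) by ring,
            show n * m * (p i - q i + 3 * δ) = n * (m * (p i - q i + 3 * δ)) by ring,
            Real.exp_nat_mul _ n, Real.exp_nat_mul _ n, ← mul_pow, ← mul_pow, Real.exp_add,
            Real.exp_add]
          congr 1
          ring
      _ ≤ _ := key _ (by
          have h5 : J - 5 * δ + (-(h0 - ε)) + (p i - q i + 3 * δ) ≤ -(c / 2) := by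
            have := hJ i
            linarith
          nlinarith [mul_le_mul_of_nonneg_left h5 hm0])
  have h4 : α * ((C ^ n)⁻¹ * ∑ i, Real.exp (n * m * (p i - q i + 3 * δ)))
      ≤ Fintype.card ι * 2⁻¹ ^ n := by
    rw [Finset.mul_sum, Finset.mul_sum]
    exact (Finset.sum_le_sum fun i _ => h3 i).trans (by simp)
  have h5 := mul_le_mul_of_nonneg_left h2 (Nat.cast_nonneg (α := ℝ) (Fintype.card ι))
  linarith

theorem iid_code {K H S Z : Type} [Fintype K] [DecidableEq K] [Fintype H] [DecidableEq H]
    [Fintype S] [Fintype Z] [DecidableEq Z] {ι : Type} [Fintype ι] [DecidableEq ι]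
    (T : ι → S → Matrix K H ℂ) (hT : ∀ i, ∑ s, (T i s)ᴴ * T i s = 1)
    (lam : H → ℝ) (hlam : ∀ a, 0 ≤ lam a) (hlam1 : ∑ a, lam a = 1)
    (y : ι → Z → Matrix K H ℂ) (hy : ∀ i z, nsq (y i z) = 1)
    (μ : ι → Z → ℝ) (hμ : ∀ i z, 0 ≤ μ i z) (hμ1 : ∀ i, ∑ z, μ i z = 1)
    (hens : ∀ i, ∑ s, vecMulVec (vc (T i s * diagonal fun a => (√(lam a) : ℂ)))
        (star (vc (T i s * diagonal fun a => (√(lam a) : ℂ))))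
      = ∑ z, (μ i z : ℂ) • vecMulVec (vc (y i z)) (star (vc (y i z))))
    (R : ι → Matrix K K ℂ) (hR : ∀ i, (R i)ᴴ * R i = 1)
    (ν : ι → K → ℝ) (hν : ∀ i e, 0 ≤ ν i e) (hν1 : ∀ i, ∑ e, ν i e = 1)
    (hout : ∀ i, ∑ s, T i s * diagonal (fun a => (lam a : ℂ)) * (T i s)ᴴ
      = R i * diagonal (fun e => (ν i e : ℂ)) * (R i)ᴴ)
    (J : ℝ) (hJ : ∀ i, J ≤ ∑ a, Real.negMulLog (lam a) + ∑ e, Real.negMulLog (ν i e)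
      - ∑ z, Real.negMulLog (μ i z)) {δ : ℝ} (hδ : 0 < δ) :
    ∀ᶠ m : ℕ in Filter.atTop, ∃ A : Finset (Fin m → H), A.Nonempty ∧
      ∃ (W : Type) (_ : Fintype W) (U : W → Matrix (Fin m → H) (Fin m → H) ℂ), IsDesign A U ∧
      ∀ n N : ℕ, N ≤ Real.exp (n * m * (J - 5 * δ)) + 1 → ∃ (w : Fin N → Fin n → W)
        (F : Fin N → Matrix ((Fin n → Fin m → K) × (Fin n → Fin m → H))
          ((Fin n → Fin m → K) × (Fin n → Fin m → H)) ℂ),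
        (∀ α, (F α).PosSemidef) ∧ (1 - ∑ α, F α).PosSemidef ∧
        ∀ α i, 1 - (8 + 8 * Fintype.card ι) * 2⁻¹ ^ n ≤
            ∑ s : Fin n → Fin m → S, ((F α * vecMulVec
              (vc (tp fun k => ((√(A.card : ℝ))⁻¹ : ℂ) •
                ((tp fun l => T i (s k l)) * (U (w α k) * indP A))))
              (star (vc (tp fun k => ((√(A.card : ℝ))⁻¹ : ℂ) •
                ((tp fun l => T i (s k l)) * (U (w α k) * indP A)))))).trace).re ∧
          ∑ s : Fin n → Fin m → S, ((F α * vecMulVec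
              (vc (tp fun k => ((√(A.card : ℝ))⁻¹ : ℂ) •
                ((tp fun l => T i (s k l)) * (U (w α k) * indP A))))
              (star (vc (tp fun k => ((√(A.card : ℝ))⁻¹ : ℂ) •
                ((tp fun l => T i (s k l)) * (U (w α k) * indP A)))))).trace).re ≤ 1 := by
  choose c₁ hc₁ H₁ using fun i => entropy_tails₂ (μ i) (hμ i) (hμ1 i) hδ
  choose c₂ hc₂ H₂ using fun i => entropy_tails₂ (ν i) (hν i) (hν1 i) hδ
  obtain ⟨b, hb, hbc⟩ := exists_pos_forall_le_of_finite (fun i => min (c₁ i) (c₂ i))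
    fun i => lt_min (hc₁ i) (hc₂ i)
  set c := min b δ
  have hc : 0 < c := lt_min hb hδ
  have hc1 : ∀ i, c ≤ c₁ i := fun i => (min_le_left _ _).trans ((hbc i).trans (min_le_left _ _))
  have hc2 : ∀ i, c ≤ c₂ i := fun i => (min_le_left _ _).trans ((hbc i).trans (min_le_right _ _))
  have hcδ : c ≤ δ := min_le_right _ _
  have hlim : Filter.Tendsto (fun m : ℕ => Real.exp (-(m * (c / 2)))) Filter.atTop (nhds 0) :=
    Real.tendsto_exp_neg_atTop_nhds_zero.comp
      (tendsto_natCast_atTop_atTop.atTop_mul_const (by positivity))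
  filter_upwards [exists_typical_set lam hlam hlam1 (show 0 < c / 4 by positivity),
    hlim.eventually_lt_const (show (0 : ℝ) < 4⁻¹ by norm_num)] with m ⟨A, hA, hAc⟩ hm
  set h0 := ∑ a, Real.negMulLog (lam a)
  have hcard : (0 : ℝ) < A.card := lt_of_lt_of_le (by positivity) hAc
  have hAn : A.Nonempty := by
    rw [← Finset.card_pos]
    exact_mod_cast hcard
  obtain ⟨W, hW, hWn, U, hU⟩ := exists_isDesign A hAn
  have hinv : (A.card : ℝ)⁻¹ ≤ 2 * Real.exp (-(m * (h0 - c / 4))) := by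
    rw [Real.exp_neg]
    calc (A.card : ℝ)⁻¹ ≤ (2⁻¹ * Real.exp (m * (h0 - c / 4)))⁻¹ := inv_anti₀ (by positivity) hAc
      _ = _ := by rw [mul_inv, inv_inv]
  refine ⟨A, hAn, W, hW, U, hU, fun n N hN => ?_⟩
  obtain ⟨w, F, h1, h2, h3⟩ := block_code T hT lam hlam y hy μ hμ hμ1 hens R hR ν hν hout
    (n := n) hAn hU (2 * Real.exp (2 * m * (c / 4))) (by
      intro a ha
      calc (A.card : ℝ)⁻¹ ≤ 2 * Real.exp (-(m * (h0 - c / 4))) := hinv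
        _ = 2 * Real.exp (2 * m * (c / 4)) * Real.exp (-(m * (h0 + c / 4))) := by
          rw [mul_assoc, ← Real.exp_add]
          ring_nf
        _ ≤ _ := by gcongr; exact hA a ha)
    (fun i => ∑ z, Real.negMulLog (μ i z)) (fun i => ∑ e, Real.negMulLog (ν i e)) δ c
    (fun i s hs => ((H₁ i n m s).1 hs).trans (by gcongr; exact hc1 i))
    (fun i s hs => ((H₂ i n m s).2 hs).trans (by gcongr; exact hc2 i)) N
  refine ⟨w, F, h1, h2, fun α i => ⟨le_trans ?_ (h3 α i).1, (h3 α i).2⟩⟩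
  refine sub_le_sub_left (error_le hJ hδ.le (by linarith) (by linarith) hcδ hm.le rfl hcard hinv ?_) _
  have h5 : ((α : ℕ) : ℝ) + 1 ≤ N := by exact_mod_cast α.2
  linarith

end IIDCode

section SingleLetter

lemma exists_ensemble_of_isHermitian {K B : Type*} [Fintype K] [DecidableEq K] [Fintype B]
    [DecidableEq B] {M : Matrix (K × B) (K × B) ℂ} (h : M.IsHermitian) :
    ∃ y : K × B → Matrix K B ℂ, (∀ z, nsq (y z) = 1) ∧
      M = ∑ z, (h.eigenvalues z : ℂ) • vecMulVec (vc (y z)) (star (vc (y z))) := by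
  refine ⟨fun z => Matrix.of fun k b => (h.eigenvectorUnitary : Matrix (K × B) (K × B) ℂ) (k, b) z,
    fun z => ?_, ?_⟩
  · have h1 := congrFun (congrFun (eigU_conjTranspose_mul h) z) z
    simp only [Matrix.mul_apply, Matrix.conjTranspose_apply, Matrix.one_apply_eq,
      Fintype.sum_prod_type] at h1
    have h2 : ((∑ k, ∑ b, ‖(h.eigenvectorUnitary : Matrix (K × B) (K × B) ℂ) (k, b) z‖ ^ 2 : ℝ) : ℂ) = 1 := by
      rw [← h1]
      push_cast
      exact Finset.sum_congr rfl fun k _ => Finset.sum_congr rfl fun b _ =>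
        (Complex.conj_mul' _).symm
    exact_mod_cast h2
  · ext p q
    conv_lhs => rw [spectral_eq h]
    rw [Matrix.mul_apply]
    simp only [Matrix.mul_diagonal, Matrix.conjTranspose_apply, Matrix.sum_apply,
      Matrix.smul_apply, vecMulVec_apply, vc, Pi.star_apply, Matrix.of_apply, smul_eq_mul]
    exact Finset.sum_congr rfl fun z _ => by ring

lemma trace_vecMulVec_vc {K B : Type*} [Fintype K] [Fintype B] (X : Matrix K B ℂ) :
    (vecMulVec (vc X) (star (vc X))).trace = (Xᴴ * X).trace := by
  rw [trace_conjTranspose_mul_self_eq, nsq, Matrix.trace, Fintype.sum_prod_type]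
  push_cast
  exact Finset.sum_congr rfl fun k _ => Finset.sum_congr rfl fun b _ => Complex.mul_conj' _

open Kronecker in
lemma vc_mul_left {K H B : Type*} [Fintype H] [Fintype B] [DecidableEq B]
    (T : Matrix K H ℂ) (X : Matrix H B ℂ) :
    vc (T * X) = (T ⊗ₖ (1 : Matrix B B ℂ)) *ᵥ vc X := by
  ext ⟨k, b⟩
  simp [vc, Matrix.mul_apply, Matrix.mulVec, dotProduct, Fintype.sum_prod_type,
    Matrix.one_apply]

lemma IsDensity.krausApply {dI dO S : ℕ} {K : Fin S → Matrix (Fin dO) (Fin dI) ℂ}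
    (hK : IsKraus K) {ρ : Matrix (Fin dI) (Fin dI) ℂ} (hρ : IsDensity ρ) :
    IsDensity (krausApply K ρ) := by
  refine ⟨Matrix.posSemidef_sum _ fun s _ => hρ.1.mul_mul_conjTranspose_same _, ?_⟩
  rw [_root_.krausApply, Matrix.trace_sum]
  simp only [Matrix.trace_mul_cycle (K _) ρ]
  rw [← Matrix.trace_sum, ← Matrix.sum_mul, hK, Matrix.one_mul, hρ.2]

lemma IsDensity.sum_eigenvalues {d : Type*} [Fintype d] [DecidableEq d] {ρ : Matrix d d ℂ}
    (hρ : IsDensity ρ) : ∑ a, hρ.1.1.eigenvalues a = 1 := by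
  have h := hρ.1.1.trace_eq_sum_eigenvalues.symm.trans hρ.2
  have h1 : ((∑ a, hρ.1.1.eigenvalues a : ℝ) : ℂ) = 1 := by
    push_cast
    exact h
  exact_mod_cast h1

lemma vnEntropy_mul_log {d : Type*} [Fintype d] [DecidableEq d] {ρ : Matrix d d ℂ}
    (h : ρ.IsHermitian) :
    vnEntropy ρ * Real.log 2 = ∑ a, Real.negMulLog (h.eigenvalues a) := by
  rw [vnEntropy, dif_pos h, div_mul_cancel₀ _ (Real.log_pos one_lt_two).ne']

lemma krausApplyExt_canonPurif {dI dO S : ℕ} (K : Fin S → Matrix (Fin dO) (Fin dI) ℂ)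
    (ρ : Matrix (Fin dI) (Fin dI) ℂ) :
    krausApplyExt K (canonPurif ρ) = ∑ s, vecMulVec (vc (K s * matFun Real.sqrt ρ))
      (star (vc (K s * matFun Real.sqrt ρ))) := by
  simp only [vc_mul_left, vecMulVec_mulVec_star]
  rfl

lemma matFun_sqrt_conjTranspose_mul {d : Type*} [Fintype d] [DecidableEq d] {ρ : Matrix d d ℂ}
    (hρ : ρ.PosSemidef) : (matFun Real.sqrt ρ)ᴴ * matFun Real.sqrt ρ = ρ := by
  conv_rhs => rw [spectral_eq hρ.1]
  rw [matFun, dif_pos hρ.1, Matrix.star_eq_conjTranspose]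
  set u := (hρ.1.eigenvectorUnitary : Matrix d d ℂ)
  have hu : uᴴ * u = 1 := eigU_conjTranspose_mul hρ.1
  set D := diagonal fun a => ((√(hρ.1.eigenvalues a) : ℝ) : ℂ) with hD
  have hDD : Dᴴ * D = diagonal fun a => ((hρ.1.eigenvalues a : ℝ) : ℂ) := by
    rw [hD, Matrix.diagonal_conjTranspose, Matrix.diagonal_mul_diagonal]
    congr 1
    ext a
    simp only [Pi.star_apply, RCLike.star_def, Complex.conj_ofReal, ← Complex.ofReal_mul,
      Real.mul_self_sqrt (hρ.eigenvalues_nonneg a)]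
  calc (u * D * uᴴ)ᴴ * (u * D * uᴴ) = u * (Dᴴ * (uᴴ * u) * D) * uᴴ := by
        simp only [Matrix.conjTranspose_mul, Matrix.conjTranspose_conjTranspose, Matrix.mul_assoc]
    _ = _ := by rw [hu, Matrix.mul_one, hDD]

lemma IsDensity.krausApplyExt_canonPurif {dI dO S : ℕ} {K : Fin S → Matrix (Fin dO) (Fin dI) ℂ}
    (hK : IsKraus K) {ρ : Matrix (Fin dI) (Fin dI) ℂ} (hρ : IsDensity ρ) :
    IsDensity (krausApplyExt K (canonPurif ρ)) := by
  rw [_root_.krausApplyExt_canonPurif]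
  refine ⟨Matrix.posSemidef_sum _ fun s _ => Matrix.posSemidef_vecMulVec_self_star _, ?_⟩
  simp only [Matrix.trace_sum, trace_vecMulVec_vc, Matrix.conjTranspose_mul]
  have h1 : ∀ s, (matFun Real.sqrt ρ)ᴴ * (K s)ᴴ * (K s * matFun Real.sqrt ρ)
      = (matFun Real.sqrt ρ)ᴴ * ((K s)ᴴ * K s) * matFun Real.sqrt ρ := fun s => by
    simp only [Matrix.mul_assoc]
  simp only [h1]
  rw [← Matrix.trace_sum, ← Matrix.sum_mul, ← Matrix.mul_sum, hK, Matrix.mul_one,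
    matFun_sqrt_conjTranspose_mul hρ.1, hρ.2]

theorem kraus_code {dH dK S Mbr : ℕ} (Kr : Fin Mbr → Fin S → Matrix (Fin dK) (Fin dH) ℂ)
    (hKr : ∀ i, IsKraus (Kr i)) {ρ : Matrix (Fin dH) (Fin dH) ℂ} (hρ : IsDensity ρ)
    (J : ℝ) (hJ : ∀ i, J ≤ qmi (Kr i) ρ * Real.log 2) {δ : ℝ} (hδ : 0 < δ) :
    ∃ u : Matrix (Fin dH) (Fin dH) ℂ, uᴴ * u = 1 ∧
    ∀ᶠ m : ℕ in Filter.atTop, ∃ A : Finset (Fin m → Fin dH), A.Nonempty ∧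
      ∃ (W : Type) (_ : Fintype W) (U : W → Matrix (Fin m → Fin dH) (Fin m → Fin dH) ℂ),
      IsDesign A U ∧
      ∀ n N : ℕ, N ≤ Real.exp (n * m * (J - 5 * δ)) + 1 → ∃ (w : Fin N → Fin n → W)
        (F : Fin N → Matrix ((Fin n → Fin m → Fin dK) × (Fin n → Fin m → Fin dH))
          ((Fin n → Fin m → Fin dK) × (Fin n → Fin m → Fin dH)) ℂ),
        (∀ α, (F α).PosSemidef) ∧ (1 - ∑ α, F α).PosSemidef ∧
        ∀ α i, 1 - (8 + 8 * Mbr) * 2⁻¹ ^ n ≤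
            ∑ s : Fin n → Fin m → Fin S, ((F α * vecMulVec
              (vc (tp fun k => ((√(A.card : ℝ))⁻¹ : ℂ) •
                ((tp fun l => Kr i (s k l) * u) * (U (w α k) * indP A))))
              (star (vc (tp fun k => ((√(A.card : ℝ))⁻¹ : ℂ) •
                ((tp fun l => Kr i (s k l) * u) * (U (w α k) * indP A)))))).trace).re ∧
          ∑ s : Fin n → Fin m → Fin S, ((F α * vecMulVec
              (vc (tp fun k => ((√(A.card : ℝ))⁻¹ : ℂ) •
                ((tp fun l => Kr i (s k l) * u) * (U (w α k) * indP A))))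
              (star (vc (tp fun k => ((√(A.card : ℝ))⁻¹ : ℂ) •
                ((tp fun l => Kr i (s k l) * u) * (U (w α k) * indP A)))))).trace).re ≤ 1 := by
  have hτ := fun i => hρ.krausApply (hKr i)
  have hω := fun i => hρ.krausApplyExt_canonPurif (hKr i)
  set u := (hρ.1.1.eigenvectorUnitary : Matrix (Fin dH) (Fin dH) ℂ) with hu
  have huu : uᴴ * u = 1 := eigU_conjTranspose_mul hρ.1.1
  have huu' : u * uᴴ = 1 := eigU_mul_conjTranspose hρ.1.1
  choose y₀ hy₀ hy₀' using fun i => exists_ensemble_of_isHermitian (hω i).1.1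
  refine ⟨u, huu, ?_⟩
  have key := iid_code (fun i s => Kr i s * u) (by
      intro i
      have h1 : ∀ s, (Kr i s * u)ᴴ * (Kr i s * u) = uᴴ * ((Kr i s)ᴴ * Kr i s) * u := fun s => by
        simp only [Matrix.conjTranspose_mul, Matrix.mul_assoc]
      simp only [h1]
      rw [← Matrix.sum_mul, ← Matrix.mul_sum, hKr i, Matrix.mul_one, huu])
    hρ.1.1.eigenvalues hρ.1.eigenvalues_nonneg hρ.sum_eigenvalues
    (fun i z => y₀ i z * u) (fun i z => by rw [nsq_mul_right huu', hy₀])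
    (fun i => (hω i).1.1.eigenvalues) (fun i => (hω i).1.eigenvalues_nonneg)
    (fun i => (hω i).sum_eigenvalues) (by
      intro i
      have h1 := ensemble_mul_right
        ((krausApplyExt_canonPurif (Kr i) ρ).symm.trans (hy₀' i)) u
      have h2 : ∀ s, Kr i s * matFun Real.sqrt ρ * u
          = Kr i s * u * diagonal fun a => ((√(hρ.1.1.eigenvalues a) : ℝ) : ℂ) := by
        intro s
        rw [matFun, dif_pos hρ.1.1, Matrix.star_eq_conjTranspose, ← hu]
        simp only [Matrix.mul_assoc, huu, Matrix.mul_one]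
      simp only [h2] at h1
      exact h1)
    (fun i => ((hτ i).1.1.eigenvectorUnitary : Matrix (Fin dK) (Fin dK) ℂ))
    (fun i => eigU_conjTranspose_mul _)
    (fun i => (hτ i).1.1.eigenvalues) (fun i => (hτ i).1.eigenvalues_nonneg)
    (fun i => (hτ i).sum_eigenvalues) (by
      intro i
      rw [← spectral_eq (hτ i).1.1, krausApply]
      refine Finset.sum_congr rfl fun s _ => ?_
      conv_rhs => rw [spectral_eq hρ.1.1]
      simp only [Matrix.conjTranspose_mul, Matrix.mul_assoc, ← hu]) J (by
      intro i
      rw [← vnEntropy_mul_log, ← vnEntropy_mul_log, ← vnEntropy_mul_log, ← add_mul, ← sub_mul]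
      exact hJ i) hδ
  simpa only [Fintype.card_fin] using key

end SingleLetter

section Protocol

/-- Conjugation by a matrix, as a linear map. -/
def conjMap {H : Type*} [Fintype H] (C : Matrix H H ℂ) :
    Matrix H H ℂ →ₗ[ℂ] Matrix H H ℂ where
  toFun X := C * X * Cᴴ
  map_add' X Y := by rw [Matrix.mul_add, Matrix.add_mul]
  map_smul' a X := by rw [Matrix.mul_smul, Matrix.smul_mul, RingHom.id_apply]

open Kronecker in
lemma tensorExt_conjMap {H B : Type*} [Fintype H] [Fintype B] [DecidableEq B] (C : Matrix H H ℂ)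
    (M : Matrix (H × B) (H × B) ℂ) :
    tensorExt (conjMap C) M
      = (C ⊗ₖ (1 : Matrix B B ℂ)) * M * (C ⊗ₖ (1 : Matrix B B ℂ))ᴴ := by
  ext ⟨k, b⟩ ⟨k', b'⟩
  simp [tensorExt, conjMap, Matrix.mul_apply, Fintype.sum_prod_type, Matrix.one_apply,
    Finset.sum_mul]
  refine Finset.sum_congr rfl fun x _ => ?_
  rw [Finset.sum_comm]
  simp [apply_ite (starRingEnd ℂ)]

lemma tensorExt_conjMap_vecMulVec {H B : Type*} [Fintype H] [Fintype B]
    [DecidableEq B] (C : Matrix H H ℂ) (X : Matrix H B ℂ) :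
    tensorExt (conjMap C) (vecMulVec (vc X) (star (vc X)))
      = vecMulVec (vc (C * X)) (star (vc (C * X))) := by
  rw [tensorExt_conjMap, vc_mul_left, vecMulVec_mulVec_star]

lemma isCPTP_conjMap {H : Type*} [Fintype H] [DecidableEq H] {C : Matrix H H ℂ}
    (hC : Cᴴ * C = 1) : IsCPTP (conjMap C) := by
  refine ⟨fun A => ?_, fun k M hM => ?_⟩
  · rw [conjMap, LinearMap.coe_mk, AddHom.coe_mk, Matrix.trace_mul_cycle, hC, Matrix.one_mul]
  · rw [tensorExt_conjMap]
    exact hM.mul_mul_conjTranspose_same _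

open Kronecker in
lemma bigKraus_eq_tp {dH dK S Mbr : ℕ} (dB m n : ℕ)
    (Kr : Fin Mbr → Fin S → Matrix (Fin dK) (Fin dH) ℂ) (i : Fin Mbr)
    (s : Fin n → Fin m → Fin S) :
    bigKraus dB m n Kr i s = tp fun k => (tp fun l => Kr i (s k l)) ⊗ₖ
      (1 : Matrix (Fin m → Fin dB) (Fin m → Fin dB) ℂ) := by
  ext f g
  simp [bigKraus, tp, Matrix.one_apply]

lemma tp_mulVec {ι I J : Type*} [Fintype ι] [DecidableEq ι] [Fintype J] (A : ι → Matrix I J ℂ)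
    (x : ι → J → ℂ) :
    (tp A *ᵥ fun g => ∏ k, x k (g k)) = fun f => ∏ k, (A k *ᵥ x k) (f k) := by
  ext f
  simp only [Matrix.mulVec, dotProduct, tp, ← Finset.prod_mul_distrib]
  exact sum_pi_prod fun k j => A k (f k) j * x k j

lemma codeword_eq_vecMulVec {dH dB m n Msz : ℕ}
    (E : Fin Msz → Fin n → (Matrix (Fin m → Fin dH) (Fin m → Fin dH) ℂ →ₗ[ℂ]
      Matrix (Fin m → Fin dH) (Fin m → Fin dH) ℂ))
    (Ψ : Matrix (BlkIn dH dB m) (BlkIn dH dB m) ℂ) (α : Fin Msz)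
    (X : Fin n → Matrix (Fin m → Fin dH) (Fin m → Fin dB) ℂ)
    (hX : ∀ k, tensorExt (E α k) Ψ = vecMulVec (vc (X k)) (star (vc (X k)))) :
    codeword E Ψ α = vecMulVec (fun f => ∏ k, vc (X k) (f k))
      (star fun f => ∏ k, vc (X k) (f k)) := by
  ext f g
  simp [codeword, hX, vecMulVec_apply, Finset.prod_mul_distrib]

lemma bigKraus_mul_vecMulVec {dH dK S Mbr dB m n : ℕ}
    (Kr : Fin Mbr → Fin S → Matrix (Fin dK) (Fin dH) ℂ) (i : Fin Mbr)
    (s : Fin n → Fin m → Fin S) (X : Fin n → Matrix (Fin m → Fin dH) (Fin m → Fin dB) ℂ) :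
    bigKraus dB m n Kr i s * vecMulVec (fun f : Fin n → BlkIn dH dB m => ∏ k, vc (X k) (f k))
      (star fun f : Fin n → BlkIn dH dB m => ∏ k, vc (X k) (f k)) * (bigKraus dB m n Kr i s)ᴴ
      = (vecMulVec (vc (tp fun k => (tp fun l => Kr i (s k l)) * X k))
          (star (vc (tp fun k => (tp fun l => Kr i (s k l)) * X k)))).submatrix
        (Equiv.arrowProdEquivProdArrow _ _ _) (Equiv.arrowProdEquivProdArrow _ _ _) := by
  rw [← vecMulVec_mulVec_star, bigKraus_eq_tp, tp_mulVec]
  simp only [← vc_mul_left]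
  rfl

lemma trace_submatrix_mul_submatrix {I J : Type*} [Fintype I] [Fintype J] (e : I ≃ J)
    (A B : Matrix J J ℂ) : (A.submatrix e e * B.submatrix e e).trace = (A * B).trace := by
  rw [Matrix.submatrix_mul_equiv, Matrix.trace, Matrix.trace]
  exact e.sum_comp fun j => (A * B) j j

lemma codeError_mem_Icc {dH dK S Mbr dB m n N : ℕ} (hN : 1 ≤ N)
    (Kr : Fin Mbr → Fin S → Matrix (Fin dK) (Fin dH) ℂ) (γ : Fin Mbr → ℝ)
    (hγ : ∀ i, 0 < γ i) (hγ1 : ∑ i, γ i = 1)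
    (Ψ : Matrix (BlkIn dH dB m) (BlkIn dH dB m) ℂ)
    (E : Fin N → Fin n → (Matrix (Fin m → Fin dH) (Fin m → Fin dH) ℂ →ₗ[ℂ]
      Matrix (Fin m → Fin dH) (Fin m → Fin dH) ℂ))
    (F : Fin N → Matrix ((Fin n → Fin m → Fin dK) × (Fin n → Fin m → Fin dB))
          ((Fin n → Fin m → Fin dK) × (Fin n → Fin m → Fin dB)) ℂ)
    (X : Fin N → Fin n → Matrix (Fin m → Fin dH) (Fin m → Fin dB) ℂ)
    (hX : ∀ α k, tensorExt (E α k) Ψ = vecMulVec (vc (X α k)) (star (vc (X α k)))) (ε : ℝ)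
    (hF : ∀ α i, 1 - ε ≤ ∑ s : Fin n → Fin m → Fin S, ((F α *
        vecMulVec (vc (tp fun k => (tp fun l => Kr i (s k l)) * X α k))
          (star (vc (tp fun k => (tp fun l => Kr i (s k l)) * X α k)))).trace).re ∧
      ∑ s : Fin n → Fin m → Fin S, ((F α *
        vecMulVec (vc (tp fun k => (tp fun l => Kr i (s k l)) * X α k))
          (star (vc (tp fun k => (tp fun l => Kr i (s k l)) * X α k)))).trace).re ≤ 1) :
    codeError dB m n N Kr γ Ψ E (fun α => (F α).submatrix
      (Equiv.arrowProdEquivProdArrow _ _ _) (Equiv.arrowProdEquivProdArrow _ _ _))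
      ∈ Set.Icc 0 ε := by
  have h1 : ∀ α, (((F α).submatrix
      (Equiv.arrowProdEquivProdArrow _ _ _) (Equiv.arrowProdEquivProdArrow _ _ _) *
      chanOut dB m n Kr γ (codeword E Ψ α)).trace).re = ∑ i, γ i *
        ∑ s : Fin n → Fin m → Fin S, ((F α *
        vecMulVec (vc (tp fun k => (tp fun l => Kr i (s k l)) * X α k))
          (star (vc (tp fun k => (tp fun l => Kr i (s k l)) * X α k)))).trace).re := by
    intro α
    rw [chanOut, codeword_eq_vecMulVec E Ψ α (X α) (hX α)]
    simp only [bigKraus_mul_vecMulVec, Matrix.mul_sum, Matrix.mul_smul, Matrix.trace_sum,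
      Matrix.trace_smul, trace_submatrix_mul_submatrix, Complex.re_sum, Complex.real_smul,
      Complex.re_ofReal_mul]
  have hN0 : (0 : ℝ) < N := by exact_mod_cast hN
  have h2 : ∀ α, 1 - ε ≤ (((F α).submatrix
      (Equiv.arrowProdEquivProdArrow _ _ _) (Equiv.arrowProdEquivProdArrow _ _ _) *
      chanOut dB m n Kr γ (codeword E Ψ α)).trace).re := by
    intro α
    rw [h1, show 1 - ε = ∑ i, γ i * (1 - ε) by rw [← Finset.sum_mul, hγ1, one_mul]]
    exact Finset.sum_le_sum fun i _ => mul_le_mul_of_nonneg_left (hF α i).1 (hγ i).le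
  have h3 : ∀ α, (((F α).submatrix
      (Equiv.arrowProdEquivProdArrow _ _ _) (Equiv.arrowProdEquivProdArrow _ _ _) *
      chanOut dB m n Kr γ (codeword E Ψ α)).trace).re ≤ 1 := by
    intro α
    rw [h1, ← hγ1]
    exact Finset.sum_le_sum fun i _ => mul_le_of_le_one_right (hγ i).le (hF α i).2
  have h4 := Finset.sum_le_sum fun α (_ : α ∈ Finset.univ) => h2 α
  have h5 := Finset.sum_le_sum fun α (_ : α ∈ Finset.univ) => h3 α
  simp only [Finset.sum_const, Finset.card_univ, Fintype.card_fin, nsmul_eq_mul] at h4 h5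
  have h6 := mul_le_mul_of_nonneg_left h4 (inv_pos.2 hN0).le
  have h7 := mul_le_mul_of_nonneg_left h5 (inv_pos.2 hN0).le
  rw [inv_mul_cancel_left₀ hN0.ne'] at h6 h7
  rw [codeError]
  exact ⟨by linarith, by linarith⟩

lemma le_liminf_logb_ceil (x : ℝ) :
    x / Real.log 2 ≤ Filter.atTop.liminf
      (fun n : ℕ => Real.logb 2 (⌈Real.exp (n * x)⌉₊ : ℕ) / n) := by
  have h2 : 0 < Real.log 2 := Real.log_pos one_lt_two
  refine Filter.le_liminf_of_le ?_ ?_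
  · refine Filter.IsBoundedUnder.isCoboundedUnder_ge
      ⟨1 + |x| / Real.log 2, Filter.eventually_map.2 ?_⟩
    filter_upwards [Filter.eventually_ge_atTop 1] with n hn
    have hn1 : (1 : ℝ) ≤ n := by exact_mod_cast hn
    have h3 : ((⌈Real.exp (n * x)⌉₊ : ℕ) : ℝ) ≤ 2 * Real.exp (n * |x|) := by
      have h4 := (Nat.ceil_lt_add_one (Real.exp_pos (n * x)).le).le
      have h5 : Real.exp (n * x) ≤ Real.exp (n * |x|) := by gcongr; exact le_abs_self x
      have h6 : 1 ≤ Real.exp (n * |x|) := Real.one_le_exp (by positivity)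
      linarith
    have hpos : (0 : ℝ) < (⌈Real.exp (n * x)⌉₊ : ℕ) :=
      Nat.cast_pos.2 (Nat.ceil_pos.2 (Real.exp_pos _))
    have h4 : Real.log (⌈Real.exp (n * x)⌉₊ : ℕ) ≤ Real.log 2 + n * |x| := by
      refine (Real.log_le_log hpos h3).trans ?_
      rw [Real.log_mul two_ne_zero (Real.exp_pos _).ne', Real.log_exp]
    rw [Real.logb, div_div, div_le_iff₀ (by positivity)]
    refine h4.trans ?_
    rw [add_mul, one_mul, div_mul_eq_mul_div, ← mul_assoc, mul_div_right_comm,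
      mul_div_cancel_right₀ _ h2.ne']
    nlinarith
  · filter_upwards [Filter.eventually_ge_atTop 1] with n hn
    have hn1 : (0 : ℝ) < n := by exact_mod_cast hn
    rw [Real.logb, div_div, div_le_div_iff₀ h2 (by positivity)]
    have h3 : n * x ≤ Real.log (⌈Real.exp (n * x)⌉₊ : ℕ) := by
      rw [Real.le_log_iff_exp_le (Nat.cast_pos.2 (Nat.ceil_pos.2 (Real.exp_pos _)))]
      exact Nat.le_ceil _
    nlinarith

theorem exists_achievableRate {dH dK S Mbr : ℕ}
    (Kr : Fin Mbr → Fin S → Matrix (Fin dK) (Fin dH) ℂ) (hKr : ∀ i, IsKraus (Kr i))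
    (γ : Fin Mbr → ℝ) (hγ : ∀ i, 0 < γ i) (hγ1 : ∑ i, γ i = 1)
    {ρ : Matrix (Fin dH) (Fin dH) ℂ} (hρ : IsDensity ρ)
    (J : ℝ) (hJ : ∀ i, J ≤ qmi (Kr i) ρ * Real.log 2) {δ : ℝ} (hδ : 0 < δ) :
    ∀ᶠ m : ℕ in Filter.atTop, ∃ Ψ : Matrix (BlkIn dH dH m) (BlkIn dH dH m) ℂ,
      IsPureState Ψ ∧ AchievableRate Kr γ m dH Ψ (m * (J - 5 * δ) / Real.log 2) := by
  obtain ⟨u, hu, H⟩ := kraus_code Kr hKr hρ J hJ hδ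
  filter_upwards [H] with m ⟨A, hA, W, hW, U, hU, HN⟩
  have hcard : (0 : ℝ) < A.card := by exact_mod_cast hA.card_pos
  set V : Matrix (Fin m → Fin dH) (Fin m → Fin dH) ℂ := tp fun _ => u with hV
  have hVV : Vᴴ * V = 1 := by rw [hV, tp_conjTranspose, tp_mul]; simp only [hu, tp_one]
  have hUU : ∀ w, (U w)ᴴ * U w = 1 := fun w => mul_eq_one_comm.1 (hU.unitary w)
  have hC : ∀ w, (V * U w * Vᴴ)ᴴ * (V * U w * Vᴴ) = 1 := fun w => by
    calc (V * U w * Vᴴ)ᴴ * (V * U w * Vᴴ) = V * ((U w)ᴴ * (Vᴴ * V) * U w) * Vᴴ := by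
          simp only [Matrix.conjTranspose_mul, Matrix.conjTranspose_conjTranspose, Matrix.mul_assoc]
      _ = 1 := by rw [hVV, Matrix.mul_one, hUU, Matrix.mul_one, mul_eq_one_comm.1 hVV]
  set a : ℂ := ((√(A.card : ℝ))⁻¹ : ℂ) with ha
  set X₀ := a • (V * indP A) with hX₀
  let N : ℕ → ℕ := fun n => ⌈Real.exp (n * (m * (J - 5 * δ)))⌉₊
  choose w F hF1 hF2 hF3 using fun n => HN n (N n) (by
    rw [mul_assoc]
    exact (Nat.ceil_lt_add_one (Real.exp_pos _).le).le)
  have hN : ∀ n, 1 ≤ N n := fun n => Nat.ceil_pos.2 (Real.exp_pos _)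
  refine ⟨vecMulVec (vc X₀) (star (vc X₀)), ⟨vc X₀, ?_, rfl⟩, N, hN, ?_,
    fun n α k => conjMap (V * U (w n α k) * Vᴴ), fun n α => (F n α).submatrix
      (Equiv.arrowProdEquivProdArrow _ _ _) (Equiv.arrowProdEquivProdArrow _ _ _),
      fun n α k => isCPTP_conjMap (hC _), fun n α => (hF1 n α).submatrix _, fun n => ?_, ?_⟩
  · have h1 : ∑ p, Complex.normSq (vc X₀ p) = nsq X₀ := by
      simp only [Complex.normSq_eq_norm_sq, nsq, vc, Fintype.sum_prod_type]
    have h2 : nsq X₀ = nsq (a • indP A) := by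
      rw [hX₀, ← Matrix.mul_smul, nsq_mul_left hVV]
    have h3 : (nsq (a • indP A) : ℂ) = 1 := by
      rw [← trace_conjTranspose_mul_self_eq]
      simp only [indP, Matrix.conjTranspose_smul, Matrix.diagonal_conjTranspose,
        Matrix.smul_mul, Matrix.mul_smul, Matrix.diagonal_mul_diagonal, Matrix.trace_smul,
        Matrix.trace_diagonal, Pi.star_apply, smul_eq_mul]
      have h4 : ∀ b, star (if b ∈ A then (1 : ℂ) else 0) * (if b ∈ A then (1 : ℂ) else 0)
          = if b ∈ A then 1 else 0 := fun b => by split_ifs <;> simp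
      simp only [h4, Finset.sum_ite_mem, Finset.univ_inter, Finset.sum_const, nsmul_eq_mul,
        mul_one, ha]
      rw [star_inv₀, RCLike.star_def, Complex.conj_ofReal, ← mul_assoc, ← mul_inv,
        ← Complex.ofReal_mul, Real.mul_self_sqrt hcard.le, Complex.ofReal_natCast]
      exact inv_mul_cancel₀ (by exact_mod_cast hcard.ne')
    rw [h1, h2]
    exact_mod_cast h3
  · exact le_liminf_logb_ceil _
  · have h1 := (hF2 n).submatrix (Equiv.arrowProdEquivProdArrow (Fin n)
      (fun _ => Fin m → Fin dK) (fun _ => Fin m → Fin dH))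
    have h2 : (1 - ∑ α, F n α).submatrix (Equiv.arrowProdEquivProdArrow (Fin n)
      (fun _ => Fin m → Fin dK) (fun _ => Fin m → Fin dH)) (Equiv.arrowProdEquivProdArrow (Fin n)
      (fun _ => Fin m → Fin dK) (fun _ => Fin m → Fin dH)) = 1 - ∑ α, (F n α).submatrix
      (Equiv.arrowProdEquivProdArrow _ _ _) (Equiv.arrowProdEquivProdArrow _ _ _) := by
      rw [Matrix.submatrix_sub, Pi.sub_apply, Pi.sub_apply, Matrix.submatrix_one_equiv]
      congr 1
      ext f g
      simp [Matrix.sum_apply]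
    rwa [h2] at h1
  · have h1 := fun n => codeError_mem_Icc (hN n) Kr γ hγ hγ1 (vecMulVec (vc X₀) (star (vc X₀)))
      (fun α k => conjMap (V * U (w n α k) * Vᴴ)) (F n)
      (fun α k => a • (V * (U (w n α k) * indP A))) (fun α k => by
        rw [tensorExt_conjMap_vecMulVec, hX₀, Matrix.mul_smul]
        congr 3 <;>
        rw [Matrix.mul_assoc, ← Matrix.mul_assoc Vᴴ, hVV, Matrix.one_mul, Matrix.mul_assoc])
      ((8 + 8 * Mbr) * 2⁻¹ ^ n) (fun α i => by
        have h2 : ∀ s : Fin n → Fin m → Fin S, (fun k => (tp fun l => Kr i (s k l)) *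
            (a • (V * (U (w n α k) * indP A)))) = fun k => a • ((tp fun l => Kr i (s k l) * u) *
              (U (w n α k) * indP A)) := fun s => by
          ext1 k
          rw [Matrix.mul_smul, ← Matrix.mul_assoc, hV, tp_mul]
        simp only [h2]
        exact hF3 n α i)
    refine tendsto_of_tendsto_of_tendsto_of_le_of_le tendsto_const_nhds ?_
      (fun n => (h1 n).1) (fun n => (h1 n).2)
    rw [show (0 : ℝ) = (8 + 8 * Mbr) * 0 by ring]
    exact (tendsto_pow_atTop_nhds_zero_of_lt_one (by norm_num) (by norm_num)).const_mul _

end Protocol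

section Converse

/-- Partial trace over the first factor. -/
def partialTraceL {A B : Type*} [Fintype A] (M : Matrix (A × B) (A × B) ℂ) : Matrix B B ℂ :=
  Matrix.of fun b b' => ∑ a, M (a, b) (a, b')

open Kronecker in
lemma PosSemidef.card_smul_partialTraceL_sub {A B : Type*} [Fintype A] [DecidableEq A] [Fintype B]
    [DecidableEq B] {M : Matrix (A × B) (A × B) ℂ} (hM : M.PosSemidef) :
    ((Fintype.card A : ℝ) • ((1 : Matrix A A ℂ) ⊗ₖ partialTraceL M) - M).PosSemidef := by
  let D : A → A → Matrix (A × B) (A × B) ℂ := fun a a' =>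
    diagonal fun p => (if a = p.1 then 1 else 0) - (if a' = p.1 then 1 else 0)
  let E : A → A → Matrix (A × B) (A × B) ℂ := fun a a' => Matrix.single a a' 1 ⊗ₖ 1
  have h1 : (Fintype.card A : ℝ) • ((1 : Matrix A A ℂ) ⊗ₖ partialTraceL M) - M
      = (2⁻¹ : ℝ) • ∑ a, ∑ a', D a a' * M * (D a a')ᴴ
        + (Fintype.card A : ℝ) • ∑ a, ∑ a' with a' ≠ a, E a a' * M * (E a a')ᴴ := by
    ext ⟨c, b⟩ ⟨c', b'⟩
    have h2 : (∑ a, ∑ a', D a a' * M * (D a a')ᴴ) (c, b) (c', b')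
        = 2 * ((if c = c' then (Fintype.card A : ℂ) else 0) - 1) * M (c, b) (c', b') := by
      simp only [D, Matrix.sum_apply, Matrix.diagonal_conjTranspose, Matrix.mul_diagonal,
        Matrix.diagonal_mul, Pi.star_apply, star_sub, apply_ite star, star_one, star_zero]
      have h3 : ∀ (x : ℂ) (u v : A → ℂ), ∑ a, ∑ a', (u a - u a') * x * (v a - v a')
          = 2 * (Fintype.card A * ∑ a, u a * v a - (∑ a, u a) * ∑ a, v a) * x := by
        intro x u v
        have h : ∀ a a', (u a - u a') * x * (v a - v a') = x * (u a * v a) - x * (u a * v a')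
            - x * (v a * u a') + x * (u a' * v a') := fun a a' => by ring
        simp only [h, Finset.sum_add_distrib, Finset.sum_sub_distrib, ← Finset.mul_sum,
          ← Finset.sum_mul, Finset.sum_const, Finset.card_univ, nsmul_eq_mul]
        simp only [mul_left_comm (u _) (Fintype.card A : ℂ), ← Finset.mul_sum]
        ring
      rw [h3 _ (fun a => if a = c then 1 else 0) (fun a => if a = c' then 1 else 0)]
      simp [eq_comm]
    have h4 : (∑ a, ∑ a' with a' ≠ a, E a a' * M * (E a a')ᴴ) (c, b) (c', b')
        = if c = c' then (∑ a, M (a, b) (a, b')) - M (c, b) (c, b') else 0 := by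
      have h5 : ∀ a a', (E a a' * M * (E a a')ᴴ) (c, b) (c', b')
          = if a = c then (if a = c' then M (a', b) (a', b') else 0) else 0 := by
        intro a a'
        simp only [E, Matrix.conjTranspose_kronecker, Matrix.conjTranspose_single, star_one,
          Matrix.conjTranspose_one, Matrix.mul_apply, Matrix.kroneckerMap_apply,
          Fintype.sum_prod_type, Matrix.single_apply, Matrix.one_apply]
        by_cases h1 : a = c <;> by_cases h2 : a = c' <;> simp [h1, h2, ite_and]
      simp only [Matrix.sum_apply, h5]
      rw [Finset.sum_eq_single c]
      · by_cases h : c = c'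
        · subst h
          simp only [if_true]
          rw [Finset.filter_ne', ← Finset.add_sum_erase _ _ (Finset.mem_univ c)]
          ring
        · simp [h]
      · intro a _ hac
        simp [hac]
      · simp
    simp only [Matrix.sub_apply, Matrix.add_apply, Matrix.smul_apply, h2, h4,
      Matrix.kroneckerMap_apply, Matrix.one_apply, partialTraceL, Matrix.of_apply,
      Complex.real_smul]
    push_cast
    split_ifs with h
    · subst h
      ring
    · ring
  rw [h1]
  exact ((Matrix.posSemidef_sum _ fun a _ => Matrix.posSemidef_sum _ fun a' _ =>
    hM.mul_mul_conjTranspose_same _).smul (by positivity)).add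
    ((Matrix.posSemidef_sum _ fun a _ => Matrix.posSemidef_sum _ fun a' _ =>
    hM.mul_mul_conjTranspose_same _).smul (by positivity))

end Converse

section ConverseBound

open scoped MatrixOrder in
lemma exists_eq_conjTranspose_mul_self {n : Type*} [Fintype n]
    {M : Matrix n n ℂ} (hM : M.PosSemidef) : ∃ B : Matrix n n ℂ, M = Bᴴ * B := by
  classical
  exact CStarAlgebra.nonneg_iff_eq_star_mul_self.1 hM.nonneg

lemma PosSemidef.re_trace_mul_nonneg {n : Type*} [Fintype n] {M P : Matrix n n ℂ}
    (hM : M.PosSemidef) (hP : P.PosSemidef) : 0 ≤ (M * P).trace.re := by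
  obtain ⟨B, rfl⟩ := exists_eq_conjTranspose_mul_self hM
  rw [Matrix.mul_assoc, Matrix.trace_mul_comm]
  exact (Complex.le_def.1 (hP.mul_mul_conjTranspose_same B).trace_nonneg).1

lemma PosSemidef.tp {ι I : Type*} [Fintype ι] [DecidableEq ι] [Fintype I]
    {M : ι → Matrix I I ℂ} (hM : ∀ k, (M k).PosSemidef) : (tp M).PosSemidef := by
  choose B hB using fun k => exists_eq_conjTranspose_mul_self (hM k)
  rw [funext hB, ← tp_mul, ← tp_conjTranspose]
  exact Matrix.posSemidef_conjTranspose_mul_self _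

lemma PosSemidef.tensorExt {n r : Type*} [Fintype n] [Fintype r]
    {φ : Matrix n n ℂ →ₗ[ℂ] Matrix n n ℂ} (hφ : IsCPTP φ) {M : Matrix (n × r) (n × r) ℂ}
    (hM : M.PosSemidef) : (tensorExt φ M).PosSemidef := by
  let e := Fintype.equivFin r
  have h1 := hφ.2 (Fintype.card r) _ (hM.submatrix fun p : n × Fin (Fintype.card r) =>
    (p.1, e.symm p.2))
  convert h1.submatrix fun p : n × r => (p.1, e p.2) using 1
  ext p q
  simp [_root_.tensorExt]

lemma partialTraceL_tensorExt {n r : Type*} [Fintype n] {φ : Matrix n n ℂ →ₗ[ℂ] Matrix n n ℂ}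
    (hφ : ∀ A, (φ A).trace = A.trace) (M : Matrix (n × r) (n × r) ℂ) :
    partialTraceL (tensorExt φ M) = partialTraceL M := by
  ext b b'
  exact hφ (Matrix.of fun i j => M (i, b) (j, b'))

open Kronecker in
lemma partialTraceL_sum_kraus {K H B S : Type*} [Fintype K] [Fintype H] [DecidableEq H] [Fintype B]
    [DecidableEq B] [Fintype S] {T : S → Matrix K H ℂ} (hT : ∑ s, (T s)ᴴ * T s = 1)
    (M : Matrix (H × B) (H × B) ℂ) :
    partialTraceL (∑ s, (T s ⊗ₖ (1 : Matrix B B ℂ)) * M * (T s ⊗ₖ (1 : Matrix B B ℂ))ᴴ)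
      = partialTraceL M := by
  ext b b'
  have h1 : ∀ s, ∑ k, ((T s ⊗ₖ (1 : Matrix B B ℂ)) * M *
      (T s ⊗ₖ (1 : Matrix B B ℂ))ᴴ) (k, b) (k, b')
      = ((T s)ᴴ * T s * Matrix.of fun i j => M (i, b) (j, b')).trace := by
    intro s
    rw [Matrix.trace_mul_comm, ← Matrix.mul_assoc, Matrix.trace_mul_comm, ← Matrix.mul_assoc]
    refine Finset.sum_congr rfl fun k _ => ?_
    simp [Matrix.mul_apply, Fintype.sum_prod_type, Matrix.one_apply, Finset.sum_mul]
    refine Finset.sum_congr rfl fun x _ => ?_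
    rw [Finset.sum_comm]
    simp [apply_ite (starRingEnd ℂ)]
  simp only [partialTraceL, Matrix.of_apply, Matrix.sum_apply]
  rw [Finset.sum_comm]
  simp only [h1]
  rw [← Matrix.trace_sum, ← Matrix.sum_mul, hT, Matrix.one_mul]
  rfl

open Kronecker in
lemma sum_re_trace_le_card_sq {A B I : Type*} [Fintype A] [DecidableEq A] [Fintype B]
    [DecidableEq B] [Fintype I] {F ω : I → Matrix (A × B) (A × B) ℂ}
    (hF : ∀ α, (F α).PosSemidef) (hF1 : (1 - ∑ α, F α).PosSemidef) (hω : ∀ α, (ω α).PosSemidef)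
    {σ : Matrix B B ℂ} (hσ : σ.PosSemidef) (hσ1 : σ.trace = 1)
    (hωσ : ∀ α, partialTraceL (ω α) = σ) :
    ∑ α, (F α * ω α).trace.re ≤ (Fintype.card A : ℝ) ^ 2 := by
  set τ := (1 : Matrix A A ℂ) ⊗ₖ σ
  have hτ : τ.PosSemidef := Matrix.PosSemidef.one.kronecker hσ
  have h1 : ∀ α, (F α * ω α).trace.re ≤ Fintype.card A * (F α * τ).trace.re := by
    intro α
    have h2 := PosSemidef.card_smul_partialTraceL_sub (hω α)
    rw [hωσ] at h2
    have h3 := PosSemidef.re_trace_mul_nonneg (hF α) h2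
    rw [Matrix.mul_sub, Matrix.trace_sub, Matrix.mul_smul, Matrix.trace_smul, Complex.sub_re,
      Complex.real_smul, Complex.re_ofReal_mul] at h3
    linarith
  have h4 : ∑ α, (F α * τ).trace.re ≤ Fintype.card A := by
    have h5 := PosSemidef.re_trace_mul_nonneg hF1 hτ
    rw [Matrix.sub_mul, Matrix.trace_sub, Matrix.sum_mul, Matrix.trace_sum, Matrix.one_mul,
      Matrix.trace_kronecker, hσ1, Matrix.trace_one, mul_one, Complex.sub_re, Complex.re_sum,
      Complex.natCast_re] at h5
    linarith
  calc ∑ α, (F α * ω α).trace.re ≤ ∑ α, Fintype.card A * (F α * τ).trace.re :=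
        Finset.sum_le_sum fun α _ => h1 α
    _ = Fintype.card A * ∑ α, (F α * τ).trace.re := by rw [Finset.mul_sum]
    _ ≤ Fintype.card A * Fintype.card A := by gcongr
    _ = _ := (sq _).symm

lemma partialTraceL_tp {A B : Type*} [Fintype A] {n : ℕ}
    (M : Fin n → Matrix (A × B) (A × B) ℂ) :
    partialTraceL ((tp M).submatrix (Equiv.arrowProdEquivProdArrow (Fin n) (fun _ => A)
        (fun _ => B)).symm (Equiv.arrowProdEquivProdArrow (Fin n) (fun _ => A) (fun _ => B)).symm)
      = tp fun k => partialTraceL (M k) := by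
  ext b b'
  exact sum_pi_prod fun k a => M k (a, b k) (a, b' k)

lemma trace_tp {I : Type*} [Fintype I] {n : ℕ} (M : Fin n → Matrix I I ℂ) :
    (tp M).trace = ∏ k, (M k).trace :=
  sum_pi_prod fun k a => M k a a

open Kronecker in
lemma chanOut_codeword_eq {dH dK S Mbr dB m n N : ℕ}
    (Kr : Fin Mbr → Fin S → Matrix (Fin dK) (Fin dH) ℂ) (γ : Fin Mbr → ℝ)
    (Ψ : Matrix (BlkIn dH dB m) (BlkIn dH dB m) ℂ)
    (E : Fin N → Fin n → (Matrix (Fin m → Fin dH) (Fin m → Fin dH) ℂ →ₗ[ℂ]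
      Matrix (Fin m → Fin dH) (Fin m → Fin dH) ℂ)) (α : Fin N) :
    chanOut dB m n Kr γ (codeword E Ψ α) = ∑ i, γ i • tp fun k => ∑ r : Fin m → Fin S,
      ((tp fun l => Kr i (r l)) ⊗ₖ (1 : Matrix (Fin m → Fin dB) (Fin m → Fin dB) ℂ)) *
        tensorExt (E α k) Ψ *
      ((tp fun l => Kr i (r l)) ⊗ₖ (1 : Matrix (Fin m → Fin dB) (Fin m → Fin dB) ℂ))ᴴ := by
  have h1 : codeword E Ψ α = tp fun k => tensorExt (E α k) Ψ := rfl
  simp only [chanOut, h1, bigKraus_eq_tp, tp_conjTranspose, tp_mul]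
  refine Finset.sum_congr rfl fun i _ => ?_
  congr 1
  exact sum_tp fun (k : Fin n) (r : Fin m → Fin S) =>
    ((tp fun l => Kr i (r l)) ⊗ₖ (1 : Matrix (Fin m → Fin dB) (Fin m → Fin dB) ℂ)) *
        tensorExt (E α k) Ψ *
      ((tp fun l => Kr i (r l)) ⊗ₖ (1 : Matrix (Fin m → Fin dB) (Fin m → Fin dB) ℂ))ᴴ

lemma sum_success_le {dH dK S Mbr dB m n N : ℕ}
    (Kr : Fin Mbr → Fin S → Matrix (Fin dK) (Fin dH) ℂ) (hKr : ∀ i, IsKraus (Kr i))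
    (γ : Fin Mbr → ℝ) (hγ : ∀ i, 0 < γ i) (hγ1 : ∑ i, γ i = 1)
    {Ψ : Matrix (BlkIn dH dB m) (BlkIn dH dB m) ℂ} (hΨ : IsPureState Ψ)
    {E : Fin N → Fin n → (Matrix (Fin m → Fin dH) (Fin m → Fin dH) ℂ →ₗ[ℂ]
      Matrix (Fin m → Fin dH) (Fin m → Fin dH) ℂ)} (hE : ∀ α k, IsCPTP (E α k))
    {F : Fin N → Matrix (Fin n → BlkOut dK dB m) (Fin n → BlkOut dK dB m) ℂ}
    (hF : ∀ α, (F α).PosSemidef) (hF1 : (1 - ∑ α, F α).PosSemidef) :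
    ∑ α, ((F α * chanOut dB m n Kr γ (codeword E Ψ α)).trace).re
      ≤ (((dK : ℝ) ^ m) ^ n) ^ 2 := by
  obtain ⟨v, hv, rfl⟩ := hΨ
  set Ψ := vecMulVec v (star v)
  have hΨ : Ψ.PosSemidef := Matrix.posSemidef_vecMulVec_self_star _
  have hΨ1 : (partialTraceL Ψ).trace = 1 := by
    have h1 : ((∑ i, Complex.normSq (v i) : ℝ) : ℂ) = 1 := by rw [hv]; rfl
    rw [← h1, Fintype.sum_prod_type, Finset.sum_comm]
    push_cast
    exact Finset.sum_congr rfl fun b _ => Finset.sum_congr rfl fun a _ => Complex.mul_conj _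
  let e := (Equiv.arrowProdEquivProdArrow (Fin n) (fun _ => Fin m → Fin dK)
    (fun _ => Fin m → Fin dB))
  have hpsd : (partialTraceL Ψ).PosSemidef := by
    have h1 : partialTraceL Ψ = ∑ a, vecMulVec (fun b => v (a, b)) (star fun b => v (a, b)) := by
      ext b b'
      simp [partialTraceL, Matrix.sum_apply, vecMulVec_apply, Ψ]
    rw [h1]
    exact Matrix.posSemidef_sum _ fun a _ => Matrix.posSemidef_vecMulVec_self_star _
  have key := sum_re_trace_le_card_sq (A := Fin n → Fin m → Fin dK) (B := Fin n → Fin m → Fin dB)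
    (F := fun α => (F α).submatrix e.symm e.symm)
    (ω := fun α => (chanOut dB m n Kr γ (codeword E Ψ α)).submatrix e.symm e.symm)
    (fun α => (hF α).submatrix _) (by
      have h2 : (1 - ∑ α, F α).submatrix e.symm e.symm
          = 1 - ∑ α, (F α).submatrix e.symm e.symm := by
        rw [Matrix.submatrix_sub, Pi.sub_apply, Pi.sub_apply, Matrix.submatrix_one_equiv]
        congr 1
        ext f g
        simp [Matrix.sum_apply]
      rw [← h2]
      exact hF1.submatrix _)
    (fun α => by
      rw [chanOut_codeword_eq]
      exact (Matrix.posSemidef_sum _ fun i _ => (PosSemidef.tp fun k =>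
        Matrix.posSemidef_sum _ fun r _ =>
          (PosSemidef.tensorExt (hE α k) hΨ).mul_mul_conjTranspose_same _).smul
            (hγ i).le).submatrix _)
    (σ := tp fun _ => partialTraceL Ψ) (PosSemidef.tp fun _ => hpsd)
    (by rw [trace_tp, hΨ1, Finset.prod_const_one])
    (fun α => by
      have h3 : ∀ i k, _ := fun i k => partialTraceL_sum_kraus
        (T := fun r : Fin m → Fin S => tp fun l => Kr i (r l)) (by
          simp only [tp_conjTranspose, tp_mul]
          rw [sum_tp (fun (_ : Fin m) s => (Kr i s)ᴴ * Kr i s)]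
          simp only [show ∑ s, (Kr i s)ᴴ * Kr i s = 1 from hKr i, tp_one])
        (tensorExt (E α k) Ψ)
      have h4 : ∀ X : Fin Mbr → Matrix (Fin n → BlkOut dK dB m) (Fin n → BlkOut dK dB m) ℂ,
          partialTraceL ((∑ i, γ i • X i).submatrix e.symm e.symm)
          = ∑ i, γ i • partialTraceL ((X i).submatrix e.symm e.symm) := by
        intro X
        ext b b'
        simp only [partialTraceL, Matrix.of_apply, Matrix.submatrix_apply, Matrix.sum_apply,
          Matrix.smul_apply, Finset.smul_sum]
        exact Finset.sum_comm
      rw [chanOut_codeword_eq, h4]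
      simp only [e, partialTraceL_tp, h3, partialTraceL_tensorExt (hE α _).1]
      rw [← Finset.sum_smul, hγ1, one_smul])
  simp only [trace_submatrix_mul_submatrix, Fintype.card_fun, Fintype.card_fin,
    Nat.cast_pow] at key
  exact key

end ConverseBound

section Assembly

lemma AchievableRate.le {dH dK S Mbr dB m : ℕ} (hdK : 1 ≤ dK)
    {Kr : Fin Mbr → Fin S → Matrix (Fin dK) (Fin dH) ℂ} (hKr : ∀ i, IsKraus (Kr i))
    {γ : Fin Mbr → ℝ} (hγ : ∀ i, 0 < γ i) (hγ1 : ∑ i, γ i = 1)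
    {Ψ : Matrix (BlkIn dH dB m) (BlkIn dH dB m) ℂ} (hΨ : IsPureState Ψ) {R : ℝ}
    (hR : AchievableRate Kr γ m dB Ψ R) : R ≤ 1 + 2 * m * Real.logb 2 dK := by
  obtain ⟨N, hN, hR, E, F, hE, hF, hF1, herr⟩ := hR
  have hlog : 0 ≤ Real.logb 2 dK := Real.logb_nonneg (by norm_num) (by exact_mod_cast hdK)
  refine hR.trans (Filter.liminf_le_of_frequently_le (Filter.Eventually.frequently ?_)
    (Filter.isBoundedUnder_of ⟨0, fun n => div_nonneg (Real.logb_nonneg (by norm_num)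
      (by exact_mod_cast hN n)) (Nat.cast_nonneg n)⟩))
  filter_upwards [herr.eventually (gt_mem_nhds (show (0 : ℝ) < 1 / 2 by norm_num)),
    Filter.eventually_ge_atTop 1] with n hn hn1
  have h1 := sum_success_le Kr hKr γ hγ hγ1 hΨ (hE n) (hF n) (hF1 n)
  have hN0 : (0 : ℝ) < N n := by exact_mod_cast hN n
  have hn0 : (0 : ℝ) < n := by exact_mod_cast hn1
  have hd0 : (0 : ℝ) < dK := by exact_mod_cast hdK
  have h2 : (N n : ℝ) ≤ 2 * (((dK : ℝ) ^ m) ^ n) ^ 2 := by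
    have h3 : (1 : ℝ) / 2 < (N n : ℝ)⁻¹ * (((dK : ℝ) ^ m) ^ n) ^ 2 := by
      have h4 := mul_le_mul_of_nonneg_left h1 (inv_nonneg.2 hN0.le)
      rw [codeError] at hn
      linarith
    rw [inv_mul_eq_div, lt_div_iff₀ hN0] at h3
    linarith
  rw [div_le_iff₀ hn0]
  have h5 := Real.logb_le_logb_of_le (b := 2) (by norm_num) hN0 h2
  rw [Real.logb_mul (by norm_num) (by positivity), Real.logb_self_eq_one (by norm_num),
    Real.logb_pow, Real.logb_pow, Real.logb_pow] at h5
  have h6 : (1 : ℝ) ≤ n := by exact_mod_cast hn1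
  push_cast at h5
  linarith

lemma bddAbove_achievableRate {dH dK S Mbr : ℕ} (hdK : 1 ≤ dK)
    {Kr : Fin Mbr → Fin S → Matrix (Fin dK) (Fin dH) ℂ} (hKr : ∀ i, IsKraus (Kr i))
    {γ : Fin Mbr → ℝ} (hγ : ∀ i, 0 < γ i) (hγ1 : ∑ i, γ i = 1) (m : ℕ) :
    BddAbove {R : ℝ | ∃ dB : ℕ, ∃ Ψ : Matrix (BlkIn dH dB m) (BlkIn dH dB m) ℂ,
      IsPureState Ψ ∧ AchievableRate Kr γ m dB Ψ R} :=
  ⟨1 + 2 * m * Real.logb 2 dK, fun _ ⟨_, _, hΨ, hR⟩ => hR.le hdK hKr hγ hγ1 hΨ⟩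

lemma CeaM_div_le {dH dK S Mbr : ℕ} (hdK : 1 ≤ dK)
    {Kr : Fin Mbr → Fin S → Matrix (Fin dK) (Fin dH) ℂ} (hKr : ∀ i, IsKraus (Kr i))
    {γ : Fin Mbr → ℝ} (hγ : ∀ i, 0 < γ i) (hγ1 : ∑ i, γ i = 1) (m : ℕ) :
    CeaM Kr γ m / m ≤ 1 + 2 * Real.logb 2 dK := by
  have hlog : 0 ≤ Real.logb 2 dK := Real.logb_nonneg (by norm_num) (by exact_mod_cast hdK)
  rcases Nat.eq_zero_or_pos m with rfl | hm
  · simp only [CharP.cast_eq_zero, div_zero]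
    positivity
  have hm1 : (1 : ℝ) ≤ m := by exact_mod_cast hm
  rw [div_le_iff₀ (by linarith)]
  have h1 : CeaM Kr γ m ≤ 1 + 2 * m * Real.logb 2 dK :=
    Real.sSup_le (fun _ ⟨_, _, hΨ, hR⟩ => hR.le hdK hKr hγ hγ1 hΨ) (by positivity)
  linarith

lemma le_Cea {dH dK S Mbr : ℕ} (hdK : 1 ≤ dK)
    {Kr : Fin Mbr → Fin S → Matrix (Fin dK) (Fin dH) ℂ} (hKr : ∀ i, IsKraus (Kr i))
    {γ : Fin Mbr → ℝ} (hγ : ∀ i, 0 < γ i) (hγ1 : ∑ i, γ i = 1)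
    {ρ : Matrix (Fin dH) (Fin dH) ℂ} (hρ : IsDensity ρ) {x : ℝ} (hx : ∀ i, x ≤ qmi (Kr i) ρ) :
    x ≤ Cea Kr γ := by
  have hl2 : 0 < Real.log 2 := Real.log_pos (by norm_num)
  refine le_of_forall_pos_le_add fun ε hε => ?_
  have hδ : 0 < ε * Real.log 2 / 5 := by positivity
  have h1 := exists_achievableRate Kr hKr γ hγ hγ1 hρ (x * Real.log 2)
    (fun i => mul_le_mul_of_nonneg_right (hx i) hl2.le) hδ
  suffices x - ε ≤ Cea Kr γ by linarith
  refine Filter.le_limsup_of_frequently_le (Filter.Eventually.frequently ?_)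
    (Filter.isBoundedUnder_of ⟨_, CeaM_div_le hdK hKr hγ hγ1⟩)
  filter_upwards [h1, Filter.eventually_ge_atTop 1] with m ⟨Ψ, hΨ, hR⟩ hm
  have hm0 : (0 : ℝ) < m := by exact_mod_cast hm
  rw [le_div_iff₀ hm0]
  refine le_csSup (bddAbove_achievableRate hdK hKr hγ hγ1 m) ⟨dH, Ψ, hΨ, ?_⟩
  convert hR using 1
  field_simp

lemma Cea_eq_zero_of_isEmpty {dK S Mbr : ℕ}
    (Kr : Fin Mbr → Fin S → Matrix (Fin dK) (Fin 0) ℂ) (γ : Fin Mbr → ℝ) : Cea Kr γ = 0 := by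
  have h1 : ∀ m, CeaM Kr γ m / m = 0 := by
    intro m
    rcases m with _ | m
    · simp
    have h2 : {R : ℝ | ∃ dB : ℕ, ∃ Ψ : Matrix (BlkIn 0 dB (m + 1)) (BlkIn 0 dB (m + 1)) ℂ,
        IsPureState Ψ ∧ AchievableRate Kr γ (m + 1) dB Ψ R} = ∅ := by
      refine Set.eq_empty_of_forall_notMem fun R ⟨dB, Ψ, ⟨v, hv, _⟩, _⟩ => ?_
      rw [Finset.univ_eq_empty, Finset.sum_empty] at hv
      exact zero_ne_one hv
    rw [CeaM, h2, Real.sSup_empty, zero_div]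
  simp only [Cea, h1, Filter.limsup_const]

lemma IsKraus.one_le_dim {dI dO S : ℕ} (hdI : 0 < dI) {K : Fin S → Matrix (Fin dO) (Fin dI) ℂ}
    (hK : IsKraus K) : 1 ≤ dO := by
  rcases Nat.eq_zero_or_pos dO with rfl | h
  · have h1 := congrFun (congrFun hK ⟨0, hdI⟩) ⟨0, hdI⟩
    simp [Matrix.sum_apply] at h1
  · exact h

lemma exists_isDensity {d : ℕ} (hd : 0 < d) : ∃ ρ : Matrix (Fin d) (Fin d) ℂ, IsDensity ρ := by
  refine ⟨vecMulVec (Pi.single ⟨0, hd⟩ 1) (star (Pi.single ⟨0, hd⟩ 1)),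
    Matrix.posSemidef_vecMulVec_self_star _, ?_⟩
  simp [Matrix.trace_vecMulVec]

end Assembly

/-- **Direct part**: the entanglement-assisted classical capacity of the long-term memory
channel `Φ⁽ⁿ⁾ = Σᵢ γᵢ φᵢ^{⊗n}` is at least `max_ρ minᵢ I(ρ; φᵢ)`. -/
theorem direct_ea_capacity {dH dK S Mbr : ℕ} (hMbr : 0 < Mbr)
    (Kr : Fin Mbr → Fin S → Matrix (Fin dK) (Fin dH) ℂ) (hKr : ∀ i, IsKraus (Kr i))
    (γ : Fin Mbr → ℝ) (hγ : ∀ i, 0 < γ i) (hγ1 : ∑ i, γ i = 1) :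
    sSup {x : ℝ | ∃ ρ : Matrix (Fin dH) (Fin dH) ℂ, IsDensity ρ ∧
        x = Finset.univ.inf' ⟨⟨0, hMbr⟩, Finset.mem_univ _⟩ (fun i => qmi (Kr i) ρ)}
      ≤ Cea Kr γ := by
  rcases Nat.eq_zero_or_pos dH with rfl | hdH
  · rw [Cea_eq_zero_of_isEmpty]
    refine Real.sSup_le (fun x ⟨ρ, hρ, _⟩ => ?_) le_rfl
    have h1 := hρ.2
    rw [Matrix.trace, Finset.univ_eq_empty, Finset.sum_empty] at h1
    exact absurd h1 zero_ne_one
  · obtain ⟨ρ₀, hρ₀⟩ := exists_isDensity hdH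
    refine csSup_le ⟨_, ρ₀, hρ₀, rfl⟩ ?_
    rintro _ ⟨ρ, hρ, rfl⟩
    exact le_Cea (IsKraus.one_le_dim hdH (hKr ⟨0, hMbr⟩)) hKr hγ hγ1 hρ
      fun i => Finset.inf'_le _ (Finset.mem_univ i)
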